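/- Given an exact triangle of S-complexes over a commutative ring R, with S-complexes C~_i (i ∈ Z/3), morphisms λ~_i: C~_i → C~_{i−1} and homotopies K~_i: C~_i → C~_{i−2} as in the definition, there are S-chain homotopy equivalences C~_0 ≃ Cone(λ~_2)[1], C~_1 ≃ Cone(λ~_0), and C~_2 ≃ Cone(λ~_1). -/

import Mathlib

set_option maxHeartbeats 1000000

open Function

universe u

/-- A `ℤ`-graded `R`-module, presented as an `R`-module together with a family of submodules
(the homogeneous pieces). -/
structure GradedMod (R : Type u) [CommRing R] : Type (u + 1) where
  carrier : Type u
  [isAddCommGroup : AddCommGroup carrier]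
  [isModule : Module R carrier]
  grading : ℤ → Submodule R carrier

attribute [instance] GradedMod.isAddCommGroup GradedMod.isModule

namespace GradedMod

variable {R : Type u} [CommRing R]

/-- `f` is homogeneous of degree `k` with respect to the gradings. -/
def IsDeg (M N : GradedMod R) (k : ℤ) (f : M.carrier →ₗ[R] N.carrier) : Prop :=
  ∀ i : ℤ, (M.grading i).map f ≤ N.grading (i + k)

/-- The grading is an internal direct sum decomposition with finitely generated free pieces,
only finitely many of which are nonzero; i.e., the graded module is finitely generated and
free as a graded `R`-module. -/
def IsFGFree (M : GradedMod R) : Prop :=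
  DirectSum.IsInternal M.grading ∧ (∀ i : ℤ, Module.Free R ↥(M.grading i)) ∧
    (∀ i : ℤ, Module.Finite R ↥(M.grading i)) ∧ {i : ℤ | M.grading i ≠ ⊥}.Finite

/-- `e` is the sign operator `ε`, acting on the degree `i` homogeneous part by `(-1)^i`. -/
def IsSign (M : GradedMod R) (e : M.carrier →ₗ[R] M.carrier) : Prop :=
  ∀ i : ℤ, ∀ x ∈ M.grading i, e x = if Even i then x else -x

/-- The shift `M[n]`, with `M[n]_j = M_{n+j}`. -/
def shift (M : GradedMod R) (n : ℤ) : GradedMod R where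
  carrier := M.carrier
  grading j := M.grading (n + j)

/-- Direct sum (product) of graded modules. -/
def prodGM (M N : GradedMod R) : GradedMod R where
  carrier := M.carrier × N.carrier
  grading j := (M.grading j).prod (N.grading j)

/-- Tensor product of graded modules, `(M ⊗ N)_k = ⊕_{i+j=k} M_i ⊗ N_j`. -/
noncomputable def tensorGM (M N : GradedMod R) : GradedMod R where
  carrier := TensorProduct R M.carrier N.carrier
  grading k := ⨆ i : ℤ, Submodule.map₂ (TensorProduct.mk R M.carrier N.carrier)
      (M.grading i) (N.grading (k - i))

/-- Dual of a graded module: a functional has degree `-i` if it kills all `M_j`, `j ≠ i`. -/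
def dualGM (M : GradedMod R) : GradedMod R where
  carrier := Module.Dual R M.carrier
  grading j := ⨅ (i : ℤ) (_ : i ≠ -j), (M.grading i).dualAnnihilator

end GradedMod

variable {R : Type u} [CommRing R]

/-- Iterated composition of a linear endomorphism. -/
def lpow {M : Type u} [AddCommGroup M] [Module R M] (f : M →ₗ[R] M) : ℕ → (M →ₗ[R] M)
  | 0 => LinearMap.id
  | n + 1 => f ∘ₗ lpow f n

section ProdHelpers

variable {A B C D E : Type u} [AddCommGroup A] [Module R A] [AddCommGroup B] [Module R B]
  [AddCommGroup C] [Module R C] [AddCommGroup D] [Module R D] [AddCommGroup E] [Module R E]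

def pj₁ : (A × B × C) →ₗ[R] A := LinearMap.fst R A (B × C)
def pj₂ : (A × B × C) →ₗ[R] B := (LinearMap.fst R B C) ∘ₗ (LinearMap.snd R A (B × C))
def pj₃ : (A × B × C) →ₗ[R] C := (LinearMap.snd R B C) ∘ₗ (LinearMap.snd R A (B × C))

def tri (f : D →ₗ[R] A) (g : D →ₗ[R] B) (h : D →ₗ[R] C) : D →ₗ[R] A × B × C :=
  f.prod (g.prod h)

def qj₁ : (A × B × C × D) →ₗ[R] A := LinearMap.fst R A (B × C × D)
def qj₂ : (A × B × C × D) →ₗ[R] B := (LinearMap.fst R B (C × D)) ∘ₗ (LinearMap.snd R A (B × C × D))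
def qj₃ : (A × B × C × D) →ₗ[R] C :=
  (LinearMap.fst R C D) ∘ₗ (LinearMap.snd R B (C × D)) ∘ₗ (LinearMap.snd R A (B × C × D))
def qj₄ : (A × B × C × D) →ₗ[R] D :=
  (LinearMap.snd R C D) ∘ₗ (LinearMap.snd R B (C × D)) ∘ₗ (LinearMap.snd R A (B × C × D))

def quad (f : E →ₗ[R] A) (g : E →ₗ[R] B) (h : E →ₗ[R] C) (l : E →ₗ[R] D) :
    E →ₗ[R] A × B × C × D := f.prod (g.prod (h.prod l))

end ProdHelpers

/-- The data of an `S`-complex over `R`: graded modules `C` (irreducible summand) and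
`𝖱` (reducible summand), together with the component maps of the differential
`d~ = [[d, 0, 0], [v, −d, δ₂], [δ₁, 0, r]]` with respect to `C~ = C ⊕ C[-1] ⊕ 𝖱`. -/
structure SCData (R : Type u) [CommRing R] : Type (u + 1) where
  Irr : GradedMod R
  Red : GradedMod R
  d : Irr.carrier →ₗ[R] Irr.carrier
  v : Irr.carrier →ₗ[R] Irr.carrier
  δ₁ : Irr.carrier →ₗ[R] Red.carrier
  δ₂ : Red.carrier →ₗ[R] Irr.carrier
  r : Red.carrier →ₗ[R] Red.carrier

namespace SCData

/-- The five relations equivalent to `d~ ∘ d~ = 0`. -/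
def Relations (S : SCData R) : Prop :=
  S.d ∘ₗ S.d = 0 ∧
  S.δ₁ ∘ₗ S.d + S.r ∘ₗ S.δ₁ = 0 ∧
  S.d ∘ₗ S.δ₂ - S.δ₂ ∘ₗ S.r = 0 ∧
  S.d ∘ₗ S.v - S.v ∘ₗ S.d - S.δ₂ ∘ₗ S.δ₁ = 0 ∧
  S.r ∘ₗ S.r = 0

/-- The degree conditions making `d~` a degree `−1` map on `C~ = C ⊕ C[-1] ⊕ 𝖱`. -/
def Degrees (S : SCData R) : Prop :=
  S.Irr.IsDeg S.Irr (-1) S.d ∧ S.Irr.IsDeg S.Irr (-2) S.v ∧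
  S.Irr.IsDeg S.Red (-1) S.δ₁ ∧ S.Red.IsDeg S.Irr (-2) S.δ₂ ∧
  S.Red.IsDeg S.Red (-1) S.r

/-- `S` is an `S`-complex. -/
def IsSComplex (S : SCData R) : Prop :=
  S.Irr.IsFGFree ∧ S.Red.IsFGFree ∧ S.Degrees ∧ S.Relations

/-- `S` is `r`-perfect: the reducible summand is concentrated in even degrees
(which forces `r = 0` and `δ₁ ∘ v^i ∘ δ₂ = 0` for all `i ≥ 0`). -/
def RPerfect (S : SCData R) : Prop :=
  (∀ j : ℤ, Odd j → S.Red.grading j = ⊥) ∧ S.r = 0 ∧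
    ∀ i : ℕ, S.δ₁ ∘ₗ lpow S.v i ∘ₗ S.δ₂ = 0

/-- The total graded module `C~ = C ⊕ C[-1] ⊕ 𝖱`. -/
def Tot (S : SCData R) : GradedMod R where
  carrier := S.Irr.carrier × S.Irr.carrier × S.Red.carrier
  grading j := (S.Irr.grading j).prod ((S.Irr.grading (j - 1)).prod (S.Red.grading j))

/-- The total differential `d~(c, c', ρ) = (d c, v c − d c' + δ₂ ρ, δ₁ c + r ρ)`. -/
def totalDiff (S : SCData R) : S.Tot.carrier →ₗ[R] S.Tot.carrier :=
  tri (S.d ∘ₗ pj₁) (S.v ∘ₗ pj₁ - S.d ∘ₗ pj₂ + S.δ₂ ∘ₗ pj₃) (S.δ₁ ∘ₗ pj₁ + S.r ∘ₗ pj₃)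

/-- The map `χ(c, c', ρ) = (0, c, 0)`. -/
def totalChi (S : SCData R) : S.Tot.carrier →ₗ[R] S.Tot.carrier :=
  tri 0 pj₁ 0

/-- The suspension `ΣC~`: `C_Σ = C[-2] ⊕ 𝖱[-1]`, `𝖱_Σ = 𝖱`, with the differential of
Definition 2.9 of the paper. -/
def susp (S : SCData R) : SCData R where
  Irr := { carrier := S.Irr.carrier × S.Red.carrier
           grading := fun j => (S.Irr.grading (j - 2)).prod (S.Red.grading (j - 1)) }
  Red := S.Red
  d := LinearMap.prod
      (S.d ∘ₗ LinearMap.fst R S.Irr.carrier S.Red.carrier -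
        S.δ₂ ∘ₗ LinearMap.snd R S.Irr.carrier S.Red.carrier)
      (-(S.r ∘ₗ LinearMap.snd R S.Irr.carrier S.Red.carrier))
  v := LinearMap.prod (S.v ∘ₗ LinearMap.fst R S.Irr.carrier S.Red.carrier)
      (S.δ₁ ∘ₗ LinearMap.fst R S.Irr.carrier S.Red.carrier)
  δ₁ := LinearMap.snd R S.Irr.carrier S.Red.carrier
  δ₂ := LinearMap.prod (S.v ∘ₗ S.δ₂) (S.δ₁ ∘ₗ S.δ₂)
  r := S.r

/-- The negative suspension `Σ⁻¹C~`: `C_{Σ⁻¹} = C[2] ⊕ 𝖱[2]`, `𝖱_{Σ⁻¹} = 𝖱`. -/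
def negSusp (S : SCData R) : SCData R where
  Irr := { carrier := S.Irr.carrier × S.Red.carrier
           grading := fun j => (S.Irr.grading (j + 2)).prod (S.Red.grading (j + 2)) }
  Red := S.Red
  d := LinearMap.prod (S.d ∘ₗ LinearMap.fst R S.Irr.carrier S.Red.carrier)
      (S.δ₁ ∘ₗ LinearMap.fst R S.Irr.carrier S.Red.carrier +
        S.r ∘ₗ LinearMap.snd R S.Irr.carrier S.Red.carrier)
  v := LinearMap.prod (S.v ∘ₗ LinearMap.fst R S.Irr.carrier S.Red.carrier +
        S.δ₂ ∘ₗ LinearMap.snd R S.Irr.carrier S.Red.carrier) 0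
  δ₁ := S.δ₁ ∘ₗ S.v ∘ₗ LinearMap.fst R S.Irr.carrier S.Red.carrier +
        S.δ₁ ∘ₗ S.δ₂ ∘ₗ LinearMap.snd R S.Irr.carrier S.Red.carrier
  δ₂ := LinearMap.prod 0 LinearMap.id
  r := S.r

/-- `Σ^n`, the `n`-fold (negative) suspension. -/
def suspPow (S : SCData R) : ℤ → SCData R
  | Int.ofNat n => (fun X : SCData R => X.susp)^[n] S
  | Int.negSucc n => (fun X : SCData R => X.negSusp)^[n + 1] S

/-- The shifted `S`-complex `C~[n]`: gradings shifted, same differential and `χ`-map. -/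
def shiftSC (S : SCData R) (n : ℤ) : SCData R where
  Irr := S.Irr.shift n
  Red := S.Red.shift n
  d := S.d
  v := S.v
  δ₁ := S.δ₁
  δ₂ := S.δ₂
  r := S.r

end SCData

/-- A map of `S`-complexes in block form `[[λ, 0, 0], [μ, λ, Δ₂], [Δ₁, 0, ρ]]`
(equivalently, a `χ`-equivariant map `C~ → C~'`); used both for morphisms and
(with appropriate signs in the total interpretation) for homotopies. -/
structure SMap {R : Type u} [CommRing R] (S T : SCData R) : Type u where
  lam : S.Irr.carrier →ₗ[R] T.Irr.carrier
  mu : S.Irr.carrier →ₗ[R] T.Irr.carrier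
  del1 : S.Irr.carrier →ₗ[R] T.Red.carrier
  del2 : S.Red.carrier →ₗ[R] T.Irr.carrier
  rho : S.Red.carrier →ₗ[R] T.Red.carrier

namespace SMap

variable {S T U : SCData R}

/-- The component relations equivalent to `d~' λ~ = λ~ d~`. -/
def IsMor (f : SMap S T) : Prop :=
  T.d ∘ₗ f.lam - f.lam ∘ₗ S.d = 0 ∧
  f.del1 ∘ₗ S.d + f.rho ∘ₗ S.δ₁ - T.δ₁ ∘ₗ f.lam - T.r ∘ₗ f.del1 = 0 ∧
  T.d ∘ₗ f.del2 - T.δ₂ ∘ₗ f.rho + f.lam ∘ₗ S.δ₂ + f.del2 ∘ₗ S.r = 0 ∧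
  f.mu ∘ₗ S.d + T.d ∘ₗ f.mu + f.lam ∘ₗ S.v - T.v ∘ₗ f.lam + f.del2 ∘ₗ S.δ₁ - T.δ₂ ∘ₗ f.del1 = 0 ∧
  f.rho ∘ₗ S.r - T.r ∘ₗ f.rho = 0

/-- The components have the degrees of a degree `k` map of `S`-complexes. -/
def DegreesAt (f : SMap S T) (k : ℤ) : Prop :=
  S.Irr.IsDeg T.Irr k f.lam ∧ S.Irr.IsDeg T.Irr (k - 1) f.mu ∧
  S.Irr.IsDeg T.Red k f.del1 ∧ S.Red.IsDeg T.Irr (k - 1) f.del2 ∧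
  S.Red.IsDeg T.Red k f.rho

/-- Composition of morphisms of `S`-complexes, componentwise. -/
def comp (g : SMap T U) (f : SMap S T) : SMap S U where
  lam := g.lam ∘ₗ f.lam
  mu := g.lam ∘ₗ f.mu + g.mu ∘ₗ f.lam + g.del2 ∘ₗ f.del1
  del1 := g.del1 ∘ₗ f.lam + g.rho ∘ₗ f.del1
  del2 := g.lam ∘ₗ f.del2 + g.del2 ∘ₗ f.rho
  rho := g.rho ∘ₗ f.rho

/-- `K` is an `S`-chain homotopy from `f` to `g`, i.e. `d~' K~ + K~ d~ = λ~ - λ~'` where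
`K~ = [[K, 0, 0], [L, -K, M₂], [M₁, 0, J]]`, in component form. -/
def IsHtpyFrom (K f g : SMap S T) : Prop :=
  T.d ∘ₗ K.lam + K.lam ∘ₗ S.d - f.lam + g.lam = 0 ∧
  T.δ₁ ∘ₗ K.lam + T.r ∘ₗ K.del1 + K.del1 ∘ₗ S.d + K.rho ∘ₗ S.δ₁ - f.del1 + g.del1 = 0 ∧
  -(T.d ∘ₗ K.del2) + T.δ₂ ∘ₗ K.rho - K.lam ∘ₗ S.δ₂ + K.del2 ∘ₗ S.r - f.del2 + g.del2 = 0 ∧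
  T.v ∘ₗ K.lam - T.d ∘ₗ K.mu + T.δ₂ ∘ₗ K.del1 + K.mu ∘ₗ S.d - K.lam ∘ₗ S.v + K.del2 ∘ₗ S.δ₁
    - f.mu + g.mu = 0 ∧
  T.r ∘ₗ K.rho + K.rho ∘ₗ S.r - f.rho + g.rho = 0

end SMap

/-- The identity morphism. -/
def idMap (S : SCData R) : SMap S S where
  lam := LinearMap.id
  mu := 0
  del1 := 0
  del2 := 0
  rho := LinearMap.id

/-- The total map `C~ → C~'` of a morphism in block form. -/
def morTotal {S T : SCData R} (f : SMap S T) : S.Tot.carrier →ₗ[R] T.Tot.carrier :=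
  tri (f.lam ∘ₗ pj₁) (f.mu ∘ₗ pj₁ + f.lam ∘ₗ pj₂ + f.del2 ∘ₗ pj₃) (f.del1 ∘ₗ pj₁ + f.rho ∘ₗ pj₃)

/-- The total map `C~ → C~'` of a homotopy in block form. -/
def htpTotal {S T : SCData R} (K : SMap S T) : S.Tot.carrier →ₗ[R] T.Tot.carrier :=
  tri (K.lam ∘ₗ pj₁) (K.mu ∘ₗ pj₁ - K.lam ∘ₗ pj₂ + K.del2 ∘ₗ pj₃) (K.del1 ∘ₗ pj₁ + K.rho ∘ₗ pj₃)

/-- `S`-chain homotopy equivalence of `S`-complexes. -/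
def SHomotopyEquiv (S T : SCData R) : Prop :=
  ∃ (f : SMap S T) (g : SMap T S) (H₁ : SMap S S) (H₂ : SMap T T),
    f.IsMor ∧ f.DegreesAt 0 ∧ g.IsMor ∧ g.DegreesAt 0 ∧
    H₁.DegreesAt 1 ∧ SMap.IsHtpyFrom H₁ (g.comp f) (idMap S) ∧
    H₂.DegreesAt 1 ∧ SMap.IsHtpyFrom H₂ (f.comp g) (idMap T)

/-- Isomorphism of `S`-complexes: a (degree `0`) morphism with a two-sided inverse morphism. -/
def SIso (S T : SCData R) : Prop :=
  ∃ (f : SMap S T) (g : SMap T S), f.IsMor ∧ f.DegreesAt 0 ∧ g.IsMor ∧ g.DegreesAt 0 ∧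
    g.comp f = idMap S ∧ f.comp g = idMap T

/-- The suspension `Σλ~` of a morphism `λ~`, in block form. -/
def suspMap {S T : SCData R} (f : SMap S T) : SMap S.susp T.susp where
  lam := LinearMap.prod
      (f.lam ∘ₗ LinearMap.fst R S.Irr.carrier S.Red.carrier +
        f.del2 ∘ₗ LinearMap.snd R S.Irr.carrier S.Red.carrier)
      (f.rho ∘ₗ LinearMap.snd R S.Irr.carrier S.Red.carrier)
  mu := LinearMap.prod (f.mu ∘ₗ LinearMap.fst R S.Irr.carrier S.Red.carrier)
      (f.del1 ∘ₗ LinearMap.fst R S.Irr.carrier S.Red.carrier)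
  del1 := 0
  del2 := LinearMap.prod (f.mu ∘ₗ S.δ₂ + T.v ∘ₗ f.del2) (f.del1 ∘ₗ S.δ₂ + T.δ₁ ∘ₗ f.del2)
  rho := f.rho

/-- The suspension `ΣK~` of a homotopy `K~`, in block form. -/
def suspHtpy {S T : SCData R} (K : SMap S T) : SMap S.susp T.susp where
  lam := LinearMap.prod
      (K.lam ∘ₗ LinearMap.fst R S.Irr.carrier S.Red.carrier -
        K.del2 ∘ₗ LinearMap.snd R S.Irr.carrier S.Red.carrier)
      (-(K.rho ∘ₗ LinearMap.snd R S.Irr.carrier S.Red.carrier))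
  mu := LinearMap.prod (K.mu ∘ₗ LinearMap.fst R S.Irr.carrier S.Red.carrier)
      (K.del1 ∘ₗ LinearMap.fst R S.Irr.carrier S.Red.carrier)
  del1 := 0
  del2 := LinearMap.prod (T.v ∘ₗ K.del2 + K.mu ∘ₗ S.δ₂) (T.δ₁ ∘ₗ K.del2 + K.del1 ∘ₗ S.δ₂)
  rho := K.rho

/-- The sequence `τ_0 = ρ`, `τ_{i+1} = δ₁'v'^iΔ₂ + Δ₁v^iδ₂ + Σ_{j<i} δ₁'v'^j μ v^{i−1−j} δ₂`
attached to an (even degree) morphism between `r`-perfect `S`-complexes. -/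
def tauSMap {S T : SCData R} (f : SMap S T) : ℕ → (S.Red.carrier →ₗ[R] T.Red.carrier)
  | 0 => f.rho
  | i + 1 =>
      T.δ₁ ∘ₗ lpow T.v i ∘ₗ f.del2 + f.del1 ∘ₗ lpow S.v i ∘ₗ S.δ₂ +
        ∑ j ∈ Finset.range i, T.δ₁ ∘ₗ lpow T.v j ∘ₗ f.mu ∘ₗ lpow S.v (i - 1 - j) ∘ₗ S.δ₂

/-- Height `n` (for `n ≥ 0`): `τ_j = 0` for `0 ≤ j < n`. -/
def SMap.HasHeight {S T : SCData R} (f : SMap S T) (n : ℕ) : Prop :=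
  ∀ j : ℕ, j < n → tauSMap f j = 0

/-- Strong height `n`: height `n` and `τ_n` an isomorphism. -/
def SMap.StrongHeight {S T : SCData R} (f : SMap S T) (n : ℕ) : Prop :=
  f.HasHeight n ∧ Function.Bijective ⇑(tauSMap f n)

/-- The explicit model of the `n`-fold suspension `Σ^n C~` of an `r`-perfect `S`-complex:
`C_{Σ^n} = C[-2n] ⊕ ⊕_{i=0}^{n-1} 𝖱[-2i-1]` (the `m`-th factor of `Fin n → 𝖱` being
`𝖱[-2(n-1-m)-1]`), `𝖱_{Σ^n} = 𝖱`, with the components of the differential as in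
Subsection 2.4 of the paper. -/
def SCData.suspN (S : SCData R) (n : ℕ) : SCData R where
  Irr := { carrier := S.Irr.carrier × (Fin n → S.Red.carrier)
           grading := fun j => (S.Irr.grading (j - 2 * (n : ℤ))).prod
             (Submodule.pi Set.univ fun m : Fin n =>
               S.Red.grading (j - 2 * (((n - 1 - (m : ℕ) : ℕ)) : ℤ) - 1)) }
  Red := S.Red
  d := LinearMap.prod
      (S.d ∘ₗ LinearMap.fst R S.Irr.carrier (Fin n → S.Red.carrier) -
        ∑ m : Fin n, lpow S.v (m : ℕ) ∘ₗ S.δ₂ ∘ₗ LinearMap.proj m ∘ₗ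
          LinearMap.snd R S.Irr.carrier (Fin n → S.Red.carrier)) 0
  v := LinearMap.prod (S.v ∘ₗ LinearMap.fst R S.Irr.carrier (Fin n → S.Red.carrier))
      (LinearMap.pi fun m : Fin n =>
        if (m : ℕ) = 0 then S.δ₁ ∘ₗ LinearMap.fst R S.Irr.carrier (Fin n → S.Red.carrier)
        else LinearMap.proj (⟨(m : ℕ) - 1, lt_of_le_of_lt (Nat.sub_le _ _) m.isLt⟩ : Fin n) ∘ₗ
          LinearMap.snd R S.Irr.carrier (Fin n → S.Red.carrier))
  δ₁ := if h : 0 < n then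
      LinearMap.proj (⟨n - 1, Nat.sub_lt h Nat.one_pos⟩ : Fin n) ∘ₗ
        LinearMap.snd R S.Irr.carrier (Fin n → S.Red.carrier)
    else 0
  δ₂ := LinearMap.prod (lpow S.v n ∘ₗ S.δ₂) 0
  r := 0

/-- The natural morphism `ι~_n : C~ → Σ^n C~`, with `λ`-component `c ↦ (c, 0, …, 0)` and
`Δ₂`-component `θ ↦ (0, θ, 0, …, 0)`. -/
def iotaN (S : SCData R) (n : ℕ) : SMap S (S.suspN n) where
  lam := LinearMap.prod LinearMap.id 0
  mu := 0
  del1 := 0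
  del2 := LinearMap.prod 0 (LinearMap.pi fun m : Fin n => if (m : ℕ) = 0 then LinearMap.id else 0)
  rho := 0

/-- The data of a generalized height morphism between `r`-perfect `S`-complexes:
the four maps `λ, μ, Δ₁, Δ₂` and the sequence `τ_i` for `i ∈ ℤ`. -/
structure HMor {R : Type u} [CommRing R] (S T : SCData R) : Type u where
  lam : S.Irr.carrier →ₗ[R] T.Irr.carrier
  mu : S.Irr.carrier →ₗ[R] T.Irr.carrier
  del1 : S.Irr.carrier →ₗ[R] T.Red.carrier
  del2 : S.Red.carrier →ₗ[R] T.Irr.carrier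
  tau : ℤ → (S.Red.carrier →ₗ[R] T.Red.carrier)

/-- `f` is a height `n` morphism of (even) degree `k` between `r`-perfect `S`-complexes. -/
def HMor.IsHeightMor {S T : SCData R} (f : HMor S T) (n : ℤ) (k : ℤ) : Prop :=
  Even k ∧
  S.Irr.IsDeg T.Irr k f.lam ∧ S.Irr.IsDeg T.Irr (k - 1) f.mu ∧
  S.Irr.IsDeg T.Red k f.del1 ∧ S.Red.IsDeg T.Irr (k - 1) f.del2 ∧
  (∀ i : ℤ, S.Red.IsDeg T.Red (k - 2 * i) (f.tau i)) ∧
  (∀ i : ℤ, i < n → f.tau i = 0) ∧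
  (∀ i : ℕ, f.tau ((i : ℤ) + 1) =
      T.δ₁ ∘ₗ lpow T.v i ∘ₗ f.del2 + f.del1 ∘ₗ lpow S.v i ∘ₗ S.δ₂ +
        ∑ j ∈ Finset.range i, T.δ₁ ∘ₗ lpow T.v j ∘ₗ f.mu ∘ₗ lpow S.v (i - 1 - j) ∘ₗ S.δ₂) ∧
  (T.d ∘ₗ f.lam - f.lam ∘ₗ S.d -
      ∑ᶠ i : ℕ, ∑ j ∈ Finset.range (i + 1),
        lpow T.v j ∘ₗ T.δ₂ ∘ₗ f.tau (-((i : ℤ) + 1)) ∘ₗ S.δ₁ ∘ₗ lpow S.v (i - j) = 0) ∧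
  (-(T.δ₁ ∘ₗ f.lam) + f.del1 ∘ₗ S.d + ∑ᶠ i : ℕ, f.tau (-(i : ℤ)) ∘ₗ S.δ₁ ∘ₗ lpow S.v i = 0) ∧
  (f.lam ∘ₗ S.δ₂ + T.d ∘ₗ f.del2 - ∑ᶠ i : ℕ, lpow T.v i ∘ₗ T.δ₂ ∘ₗ f.tau (-(i : ℤ)) = 0) ∧
  (f.mu ∘ₗ S.d + T.d ∘ₗ f.mu + f.lam ∘ₗ S.v - T.v ∘ₗ f.lam + f.del2 ∘ₗ S.δ₁ - T.δ₂ ∘ₗ f.del1 = 0)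

/-- Composition of generalized height morphisms (Definition 2.23 of the paper). -/
noncomputable def HMor.compH {S T U : SCData R} (g : HMor T U) (f : HMor S T) : HMor S U where
  lam := g.lam ∘ₗ f.lam
    + (∑ᶠ i : ℕ, ∑ j ∈ Finset.range (i + 1),
        lpow U.v j ∘ₗ U.δ₂ ∘ₗ g.tau (-((i : ℤ) + 1)) ∘ₗ f.del1 ∘ₗ lpow S.v (i - j))
    + (∑ᶠ i : ℕ, ∑ j ∈ Finset.range (i + 1),
        lpow U.v j ∘ₗ g.del2 ∘ₗ f.tau (-((i : ℤ) + 1)) ∘ₗ S.δ₁ ∘ₗ lpow S.v (i - j))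
    + (∑ᶠ i : ℕ, ∑ j ∈ Finset.range (i + 1), ∑ l ∈ Finset.range (i - j + 1),
        lpow U.v j ∘ₗ U.δ₂ ∘ₗ g.tau (-((i : ℤ) + 2)) ∘ₗ T.δ₁ ∘ₗ lpow T.v l ∘ₗ f.mu ∘ₗ
          lpow S.v (i - j - l))
    + (∑ᶠ i : ℕ, ∑ j ∈ Finset.range (i + 1), ∑ l ∈ Finset.range (i - j + 1),
        lpow U.v j ∘ₗ g.mu ∘ₗ lpow T.v l ∘ₗ T.δ₂ ∘ₗ f.tau (-((i : ℤ) + 2)) ∘ₗ S.δ₁ ∘ₗ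
          lpow S.v (i - j - l))
  mu := g.lam ∘ₗ f.mu + g.mu ∘ₗ f.lam + g.del2 ∘ₗ f.del1
  del1 := g.del1 ∘ₗ f.lam + (∑ᶠ i : ℕ, g.tau (-(i : ℤ)) ∘ₗ f.del1 ∘ₗ lpow S.v i)
    + (∑ᶠ i : ℕ, ∑ j ∈ Finset.range (i + 1),
        g.tau (-((i : ℤ) + 1)) ∘ₗ T.δ₁ ∘ₗ lpow T.v j ∘ₗ f.mu ∘ₗ lpow S.v (i - j))
  del2 := g.lam ∘ₗ f.del2 + (∑ᶠ i : ℕ, lpow U.v i ∘ₗ g.del2 ∘ₗ f.tau (-(i : ℤ)))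
    + (∑ᶠ i : ℕ, ∑ j ∈ Finset.range (i + 1),
        lpow U.v j ∘ₗ g.mu ∘ₗ lpow T.v (i - j) ∘ₗ T.δ₂ ∘ₗ f.tau (-((i : ℤ) + 1)))
  tau := fun i => ∑ᶠ l : ℤ, g.tau (i - l) ∘ₗ f.tau l

/-- The strong height `−n` morphism `κ~_n : Σ^n C~ → C~`. -/
def kappaN (T : SCData R) (n : ℕ) : HMor (T.suspN n) T where
  lam := LinearMap.fst R T.Irr.carrier (Fin n → T.Red.carrier)
  mu := 0
  del1 := 0
  del2 := 0
  tau := fun i => if i = -(n : ℤ) then LinearMap.id else 0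

/-- An (even degree) morphism of `S`-complexes, regarded as a generalized height morphism. -/
def SMap.toHMor {S T : SCData R} (f : SMap S T) : HMor S T where
  lam := f.lam
  mu := f.mu
  del1 := f.del1
  del2 := f.del2
  tau := fun i => if 0 ≤ i then tauSMap f i.toNat else 0

/-- The height `0` morphism `λ~' : C~ → Σ^n C~'` associated to a height `−n` morphism
(Proposition 2.25 of the paper). -/
def heightNegToSusp {S T : SCData R} (f : HMor S T) (n : ℕ) : SMap S (T.suspN n) where
  lam := LinearMap.prod f.lam
    (LinearMap.pi fun m : Fin n =>
      ∑ i ∈ Finset.Icc ((m : ℕ) + 1) n, f.tau (-(i : ℤ)) ∘ₗ S.δ₁ ∘ₗ lpow S.v (i - 1 - (m : ℕ)))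
  mu := LinearMap.prod f.mu (LinearMap.pi fun m : Fin n => if (m : ℕ) = 0 then f.del1 else 0)
  del1 := 0
  del2 := LinearMap.prod f.del2 (LinearMap.pi fun m : Fin n => f.tau (-((m : ℕ) : ℤ)))
  rho := f.tau (-(n : ℤ))

/-- The morphism `ι~₁ : C~ → ΣC~`. -/
def iotaOne (S : SCData R) : SMap S S.susp where
  lam := LinearMap.prod LinearMap.id 0
  mu := 0
  del1 := 0
  del2 := LinearMap.prod 0 LinearMap.id
  rho := 0

/-- The morphism `λ~'' : ΣC~' → C~''` associated to an odd degree morphism `λ~'` together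
with the map `ν' : 𝖱' → 𝖱''` (Subsection 2.6 of the paper). -/
def lambdaSecond {S T : SCData R} (f : SMap S T) (nu : S.Red.carrier →ₗ[R] T.Red.carrier) :
    SMap S.susp T where
  lam := f.lam ∘ₗ LinearMap.fst R S.Irr.carrier S.Red.carrier +
    f.del2 ∘ₗ LinearMap.snd R S.Irr.carrier S.Red.carrier
  mu := f.mu ∘ₗ LinearMap.fst R S.Irr.carrier S.Red.carrier
  del1 := f.del1 ∘ₗ LinearMap.fst R S.Irr.carrier S.Red.carrier +
    nu ∘ₗ LinearMap.snd R S.Irr.carrier S.Red.carrier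
  del2 := f.mu ∘ₗ S.δ₂ + T.v ∘ₗ f.del2 + T.δ₂ ∘ₗ nu
  rho := 0

/-- The morphism `λ~₁ : C~ → ΣC~'` associated to height `−1` morphism data
`(λ, μ, Δ₁, Δ₂, τ₀, τ₋₁)`, in block form
`[[λ, 0, 0], [τ₋₁δ₁, 0, 0], [μ, λ, Δ₂], [Δ₁, τ₋₁δ₁, τ₀], [0, 0, τ₋₁]]`. -/
def hNegOneSusp {S T : SCData R} (lam0 mu0 : S.Irr.carrier →ₗ[R] T.Irr.carrier)
    (del10 : S.Irr.carrier →ₗ[R] T.Red.carrier) (del20 : S.Red.carrier →ₗ[R] T.Irr.carrier)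
    (tau0 taum1 : S.Red.carrier →ₗ[R] T.Red.carrier) : SMap S T.susp where
  lam := LinearMap.prod lam0 (taum1 ∘ₗ S.δ₁)
  mu := LinearMap.prod mu0 del10
  del1 := 0
  del2 := LinearMap.prod del20 tau0
  rho := taum1

/-- The mapping cone of a degree `k` morphism `λ~ : C~ → C~'`, as an `S`-complex;
its underlying graded module is `C~[-1-k] ⊕ C~'`. -/
def coneSC {S T : SCData R} (f : SMap S T) (k : ℤ) : SCData R where
  Irr := { carrier := S.Irr.carrier × T.Irr.carrier
           grading := fun j => (S.Irr.grading (j - 1 - k)).prod (T.Irr.grading j) }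
  Red := { carrier := S.Red.carrier × T.Red.carrier
           grading := fun j => (S.Red.grading (j - 1 - k)).prod (T.Red.grading j) }
  d := LinearMap.prod (-(S.d ∘ₗ LinearMap.fst R S.Irr.carrier T.Irr.carrier))
      (f.lam ∘ₗ LinearMap.fst R S.Irr.carrier T.Irr.carrier +
        T.d ∘ₗ LinearMap.snd R S.Irr.carrier T.Irr.carrier)
  v := LinearMap.prod (S.v ∘ₗ LinearMap.fst R S.Irr.carrier T.Irr.carrier)
      (f.mu ∘ₗ LinearMap.fst R S.Irr.carrier T.Irr.carrier +
        T.v ∘ₗ LinearMap.snd R S.Irr.carrier T.Irr.carrier)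
  δ₁ := LinearMap.prod (-(S.δ₁ ∘ₗ LinearMap.fst R S.Irr.carrier T.Irr.carrier))
      (f.del1 ∘ₗ LinearMap.fst R S.Irr.carrier T.Irr.carrier +
        T.δ₁ ∘ₗ LinearMap.snd R S.Irr.carrier T.Irr.carrier)
  δ₂ := LinearMap.prod (S.δ₂ ∘ₗ LinearMap.fst R S.Red.carrier T.Red.carrier)
      (f.del2 ∘ₗ LinearMap.fst R S.Red.carrier T.Red.carrier +
        T.δ₂ ∘ₗ LinearMap.snd R S.Red.carrier T.Red.carrier)
  r := LinearMap.prod (-(S.r ∘ₗ LinearMap.fst R S.Red.carrier T.Red.carrier))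
      (f.rho ∘ₗ LinearMap.fst R S.Red.carrier T.Red.carrier +
        T.r ∘ₗ LinearMap.snd R S.Red.carrier T.Red.carrier)

/-- Direct sum of `S`-complexes. -/
def sumSC (S T : SCData R) : SCData R where
  Irr := S.Irr.prodGM T.Irr
  Red := S.Red.prodGM T.Red
  d := S.d.prodMap T.d
  v := S.v.prodMap T.v
  δ₁ := S.δ₁.prodMap T.δ₁
  δ₂ := S.δ₂.prodMap T.δ₂
  r := S.r.prodMap T.r

/-- The dual `S`-complex `C~†`, defined using sign operators on the dual graded modules:
`m†(f) = −ε(f) f ∘ m`, with the roles of `δ₁` and `δ₂` interchanged. -/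
def dualSC (S : SCData R)
    (eCd : Module.Dual R S.Irr.carrier →ₗ[R] Module.Dual R S.Irr.carrier)
    (eRd : Module.Dual R S.Red.carrier →ₗ[R] Module.Dual R S.Red.carrier) : SCData R where
  Irr := S.Irr.dualGM
  Red := S.Red.dualGM
  d := -(S.d.dualMap ∘ₗ eCd)
  v := -(S.v.dualMap ∘ₗ eCd)
  δ₁ := -(S.δ₂.dualMap ∘ₗ eCd)
  δ₂ := -(S.δ₁.dualMap ∘ₗ eRd)
  r := -(S.r.dualMap ∘ₗ eRd)

/-- The rank-one graded module `R`, concentrated in degree `n`. -/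
def unitGM (R : Type u) [CommRing R] (n : ℤ) : GradedMod R where
  carrier := R
  grading j := if j = n then ⊤ else ⊥

/-- The `S`-complex `O~(1)`: `C = R` in degree `1`, `𝖱 = R` in degree `0`, `δ₁ = id`. -/
def O1 (R : Type u) [CommRing R] : SCData R where
  Irr := unitGM R 1
  Red := unitGM R 0
  d := 0
  v := 0
  δ₁ := LinearMap.id
  δ₂ := 0
  r := 0

/-- The `S`-complex `O~(-1)`: `C = R` in degree `-2`, `𝖱 = R` in degree `0`, `δ₂ = id`. -/
def Om1 (R : Type u) [CommRing R] : SCData R where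
  Irr := unitGM R (-2)
  Red := unitGM R 0
  d := 0
  v := 0
  δ₁ := 0
  δ₂ := LinearMap.id
  r := 0

/-- The `S`-complex `O~(0)`: `C = 0`, `𝖱 = R` in degree `0`, zero differential. -/
def O0 (R : Type u) [CommRing R] : SCData R where
  Irr := { carrier := ↥(⊥ : Submodule R R), grading := fun _ => ⊥ }
  Red := unitGM R 0
  d := 0
  v := 0
  δ₁ := 0
  δ₂ := 0
  r := 0

/-- The `S`-complex representation of the tensor product `C~ ⊗ C~'` of `S`-complexes
(Subsection 2.2 of the paper), where `eC`, `eR` are the sign operators of the first factor: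
`C^⊗ = (C⊗C') ⊕ (C⊗C')[-1] ⊕ (C⊗𝖱') ⊕ (𝖱⊗C')` and `𝖱^⊗ = 𝖱⊗𝖱'`. -/
noncomputable def tensorRep (S T : SCData R)
    (eC : S.Irr.carrier →ₗ[R] S.Irr.carrier) (eR : S.Red.carrier →ₗ[R] S.Red.carrier) :
    SCData R where
  Irr := (S.Irr.tensorGM T.Irr).prodGM (((S.Irr.tensorGM T.Irr).shift (-1)).prodGM
      ((S.Irr.tensorGM T.Red).prodGM (S.Red.tensorGM T.Irr)))
  Red := S.Red.tensorGM T.Red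
  d := quad
      (TensorProduct.map S.d LinearMap.id ∘ₗ qj₁ + TensorProduct.map eC T.d ∘ₗ qj₁)
      (TensorProduct.map (-(eC ∘ₗ S.v)) LinearMap.id ∘ₗ qj₁ + TensorProduct.map eC T.v ∘ₗ qj₁
        + TensorProduct.map S.d LinearMap.id ∘ₗ qj₂ - TensorProduct.map eC T.d ∘ₗ qj₂
        + TensorProduct.map eC T.δ₂ ∘ₗ qj₃
        + TensorProduct.map (-(eC ∘ₗ S.δ₂)) LinearMap.id ∘ₗ qj₄)
      (TensorProduct.map eC T.δ₁ ∘ₗ qj₁ + TensorProduct.map S.d LinearMap.id ∘ₗ qj₃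
        + TensorProduct.map eC T.r ∘ₗ qj₃)
      (TensorProduct.map S.δ₁ LinearMap.id ∘ₗ qj₁ + TensorProduct.map eR T.d ∘ₗ qj₄
        + TensorProduct.map S.r LinearMap.id ∘ₗ qj₄)
  v := quad
      (TensorProduct.map S.v LinearMap.id ∘ₗ qj₁ + TensorProduct.map S.δ₂ LinearMap.id ∘ₗ qj₄)
      (TensorProduct.map S.v LinearMap.id ∘ₗ qj₂)
      (TensorProduct.map S.v LinearMap.id ∘ₗ qj₃)
      (TensorProduct.map (eR ∘ₗ S.δ₁) LinearMap.id ∘ₗ qj₂ + TensorProduct.map LinearMap.id T.v ∘ₗ qj₄)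
  δ₁ := TensorProduct.map S.δ₁ LinearMap.id ∘ₗ qj₃ + TensorProduct.map eR T.δ₁ ∘ₗ qj₄
  δ₂ := quad 0 0 (TensorProduct.map S.δ₂ LinearMap.id) (TensorProduct.map LinearMap.id T.δ₂)
  r := TensorProduct.map S.r LinearMap.id + TensorProduct.map eR T.r

/-- Homology of an endomorphism (thought of as a differential): `ker D / im D`. -/
abbrev homologyOf {M : Type u} [AddCommGroup M] [Module R M] (D : M →ₗ[R] M) : Type u :=
  ↥(LinearMap.ker D) ⧸
    Submodule.comap (LinearMap.ker D).subtype (LinearMap.range D)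

/-- The map induced on homology by a chain map. -/
def inducedMap {M N : Type u} [AddCommGroup M] [Module R M] [AddCommGroup N] [Module R N]
    (DM : M →ₗ[R] M) (DN : N →ₗ[R] N) (f : M →ₗ[R] N) (h : DN ∘ₗ f = f ∘ₗ DM) :
    homologyOf DM →ₗ[R] homologyOf DN :=
  Submodule.mapQ _ _
    (f.restrict (p := LinearMap.ker DM) (q := LinearMap.ker DN) (fun x hx => by
      have h1 : DN (f x) = f (DM x) := by
        have h2 := LinearMap.congr_fun h x
        simpa using h2
      have hx0 : DM x = 0 := LinearMap.mem_ker.mp hx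
      simp [LinearMap.mem_ker, h1, hx0]))
    (by
      intro x hx
      simp only [Submodule.mem_comap] at hx ⊢
      obtain ⟨y, hy⟩ := hx
      refine ⟨f y, ?_⟩
      have h1 : DN (f y) = f (DM y) := by
        have h2 := LinearMap.congr_fun h y
        simpa using h2
      simp only [Submodule.coe_subtype] at hy ⊢
      rw [LinearMap.restrict_apply]
      rw [h1, hy])

/-- The degree `j` homology of a graded module with a (degree `-1`) differential. -/
abbrev gradedHomology (M : GradedMod R) (D : M.carrier →ₗ[R] M.carrier) (j : ℤ) : Type u :=
  ↥(M.grading j ⊓ LinearMap.ker D) ⧸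
    Submodule.comap (M.grading j ⊓ LinearMap.ker D).subtype ((M.grading (j + 1)).map D)

/-- The Euler characteristic `Σ_j (-1)^j rk_R M_j` of a graded module. -/
noncomputable def eulerChar (M : GradedMod R) : ℤ :=
  ∑ᶠ j : ℤ, (if Even j then (1 : ℤ) else -1) * (Module.finrank R ↥(M.grading j) : ℤ)

/-- The small equivariant complex `Ĉ = C[-1] ⊕ 𝖱[x]`, with `𝖱[x]` modelled as `ℕ →₀ 𝖱`. -/
abbrev hatC (S : SCData R) : Type u := S.Irr.carrier × (ℕ →₀ S.Red.carrier)

/-- The differential `𝔡̂(α, θxⁱ) = (dα − vⁱδ₂θ, 0)`. -/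
noncomputable def hatD (S : SCData R) : hatC S →ₗ[R] hatC S :=
  LinearMap.prod
    (S.d ∘ₗ LinearMap.fst R S.Irr.carrier (ℕ →₀ S.Red.carrier) -
      (Finsupp.lsum ℕ fun i : ℕ => lpow S.v i ∘ₗ S.δ₂) ∘ₗ
        LinearMap.snd R S.Irr.carrier (ℕ →₀ S.Red.carrier))
    0

/-- The `x`-action `x·(α, θxⁱ) = (vα, δ₁α + θx^{i+1})` on `Ĉ`. -/
noncomputable def hatX (S : SCData R) : hatC S →ₗ[R] hatC S :=
  LinearMap.prod (S.v ∘ₗ LinearMap.fst R S.Irr.carrier (ℕ →₀ S.Red.carrier))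
    (Finsupp.lsingle 0 ∘ₗ S.δ₁ ∘ₗ LinearMap.fst R S.Irr.carrier (ℕ →₀ S.Red.carrier) +
      Finsupp.lmapDomain S.Red.carrier R (fun i => i + 1) ∘ₗ
        LinearMap.snd R S.Irr.carrier (ℕ →₀ S.Red.carrier))

/-- The small equivariant complex `Č = C ⊕ 𝖱[[x⁻¹,x]/𝖱[x]`, the tail modelled as `ℕ → 𝖱`
(the `m`-th coordinate is the coefficient of `x^{-m-1}`). -/
abbrev checkC (S : SCData R) : Type u := S.Irr.carrier × (ℕ → S.Red.carrier)

/-- The differential `𝔡̌(α, θxⁱ) = (dα, Σ_{j≤-1} δ₁v^{−j−1}(α)xʲ)`. -/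
noncomputable def checkD (S : SCData R) : checkC S →ₗ[R] checkC S :=
  LinearMap.prod (S.d ∘ₗ LinearMap.fst R S.Irr.carrier (ℕ → S.Red.carrier))
    (LinearMap.pi fun m : ℕ =>
      S.δ₁ ∘ₗ lpow S.v m ∘ₗ LinearMap.fst R S.Irr.carrier (ℕ → S.Red.carrier))

/-- The `x`-action on `Č`. -/
noncomputable def checkX (S : SCData R) : checkC S →ₗ[R] checkC S :=
  LinearMap.prod
    (S.v ∘ₗ LinearMap.fst R S.Irr.carrier (ℕ → S.Red.carrier) +
      S.δ₂ ∘ₗ LinearMap.proj 0 ∘ₗ LinearMap.snd R S.Irr.carrier (ℕ → S.Red.carrier))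
    (LinearMap.pi fun m : ℕ =>
      LinearMap.proj (m + 1) ∘ₗ LinearMap.snd R S.Irr.carrier (ℕ → S.Red.carrier))

/-- The module `𝖱[[x⁻¹,x]` of Laurent series with finitely many positive powers, modelled
as (polynomial part, tail): `(ℕ →₀ 𝖱) × (ℕ → 𝖱)`. -/
abbrev barC (S : SCData R) : Type u := (ℕ →₀ S.Red.carrier) × (ℕ → S.Red.carrier)

/-- Multiplication by `x` on `𝖱[[x⁻¹,x]`. -/
noncomputable def barX (S : SCData R) : barC S →ₗ[R] barC S :=
  LinearMap.prod
    (Finsupp.lsingle 0 ∘ₗ LinearMap.proj 0 ∘ₗ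
        LinearMap.snd R (ℕ →₀ S.Red.carrier) (ℕ → S.Red.carrier) +
      Finsupp.lmapDomain S.Red.carrier R (fun i => i + 1) ∘ₗ
        LinearMap.fst R (ℕ →₀ S.Red.carrier) (ℕ → S.Red.carrier))
    (LinearMap.pi fun m : ℕ =>
      LinearMap.proj (m + 1) ∘ₗ LinearMap.snd R (ℕ →₀ S.Red.carrier) (ℕ → S.Red.carrier))

/-- The chain map `𝔦 : Ĉ → 𝖱[[x⁻¹,x]`, `(α, θ) ↦ Σ_{i≤-1} δ₁v^{−i−1}(α)xⁱ + θ`. -/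
noncomputable def mapI (S : SCData R) : hatC S →ₗ[R] barC S :=
  LinearMap.prod (LinearMap.snd R S.Irr.carrier (ℕ →₀ S.Red.carrier))
    (LinearMap.pi fun m : ℕ =>
      S.δ₁ ∘ₗ lpow S.v m ∘ₗ LinearMap.fst R S.Irr.carrier (ℕ →₀ S.Red.carrier))

/-- The chain map `𝔧 : Č → Ĉ`, `(α, ·) ↦ (−α, 0)`. -/
noncomputable def mapJ (S : SCData R) : checkC S →ₗ[R] hatC S :=
  LinearMap.prod (-(LinearMap.fst R S.Irr.carrier (ℕ → S.Red.carrier))) 0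

/-- The chain map `𝔭 : 𝖱[[x⁻¹,x] → Č`, `Σθᵢxⁱ ↦ (Σ_{i≥0} vⁱδ₂θᵢ, Σ_{i≤-1} θᵢxⁱ)`. -/
noncomputable def mapP (S : SCData R) : barC S →ₗ[R] checkC S :=
  LinearMap.prod
    ((Finsupp.lsum ℕ fun i : ℕ => lpow S.v i ∘ₗ S.δ₂) ∘ₗ
      LinearMap.fst R (ℕ →₀ S.Red.carrier) (ℕ → S.Red.carrier))
    (LinearMap.snd R (ℕ →₀ S.Red.carrier) (ℕ → S.Red.carrier))

/-- The coefficient of `xᵉ`, as a linear map `𝖱[[x⁻¹,x] → 𝖱`. -/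
noncomputable def coeffLM (S : SCData R) (e : ℤ) : barC S →ₗ[R] S.Red.carrier :=
  if 0 ≤ e then
    Finsupp.lapply e.toNat ∘ₗ LinearMap.fst R (ℕ →₀ S.Red.carrier) (ℕ → S.Red.carrier)
  else
    LinearMap.proj (-e - 1).toNat ∘ₗ LinearMap.snd R (ℕ →₀ S.Red.carrier) (ℕ → S.Red.carrier)

/-- `𝔍(C~) ⊆ 𝖱[[x⁻¹,x]`, the image of `i⋆ : Ĥ → 𝖱[[x⁻¹,x]` (equal to `𝔦(ker 𝔡̂)`). -/
noncomputable def Jmod (S : SCData R) : Submodule R (barC S) :=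
  (LinearMap.ker (hatD S)).map (mapI S)

/-- `J_i(C~) = { a₀ ∈ 𝖱 | ∃ a₀x^{-i} + a₋₁x^{-i-1} + ⋯ ∈ 𝔍(C~) }`. -/
noncomputable def Jset (S : SCData R) (i : ℤ) : Submodule R S.Red.carrier :=
  ((Jmod S) ⊓ ⨅ (e : ℤ) (_ : -i < e), LinearMap.ker (coeffLM S e)).map (coeffLM S (-i))

/-- The function `d_{C~}(i) = rk_R J_i(C~)`. -/
noncomputable def dFun (S : SCData R) (i : ℤ) : ℕ := Module.finrank R ↥(Jset S i)

section EquivariantComplexes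

variable {A B C : Type u} [AddCommGroup A] [Module R A] [AddCommGroup B] [Module R B]
  [AddCommGroup C] [Module R C]

/-- A chain map `F` commuting with the `χ`-maps is an equivariant homotopy equivalence as soon as
some equivariant chain map `G` makes `G F` and `F G` equivariantly homotopic to bijections. -/
theorem exists_equivariant_homotopy_inverse {dA χA : A →ₗ[R] A} {dB χB : B →ₗ[R] B}
    {F : A →ₗ[R] B} {G : B →ₗ[R] A} {P H : A →ₗ[R] A} {Q X : B →ₗ[R] B}
    (hdA : ∀ x, dA (dA x) = 0) (hdB : ∀ y, dB (dB y) = 0)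
    (hχA : ∀ x, χA (dA x) = -dA (χA x)) (hχB : ∀ y, χB (dB y) = -dB (χB y))
    (hFd : ∀ x, dB (F x) = F (dA x)) (hFχ : ∀ x, χB (F x) = F (χA x))
    (hGd : ∀ y, dA (G y) = G (dB y)) (hGχ : ∀ y, χA (G y) = G (χB y))
    (hP : Function.Bijective P) (hQ : Function.Bijective Q)
    (hGF : ∀ x, G (F x) = P x + dA (H x) + H (dA x)) (hH : ∀ x, χA (H x) = -H (χA x))
    (hFG : ∀ y, F (G y) = Q y + dB (X y) + X (dB y)) (hX : ∀ y, χB (X y) = -X (χB y)) :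
    ∃ (L : B →ₗ[R] A) (H₁ : A →ₗ[R] A) (H₂ : B →ₗ[R] B),
      (∀ y, dA (L y) = L (dB y)) ∧ (∀ y, χA (L y) = L (χB y)) ∧
      (∀ x, dA (H₁ x) + H₁ (dA x) = L (F x) - x) ∧ (∀ x, χA (H₁ x) = -H₁ (χA x)) ∧
      (∀ y, dB (H₂ y) + H₂ (dB y) = F (L y) - y) ∧ (∀ y, χB (H₂ y) = -H₂ (χB y)) := by
  have commute_symm {M : Type u} [AddCommGroup M] [Module R M] {g : M →ₗ[R] M} (e : M ≃ₗ[R] M)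
      (h : ∀ x, g (e x) = e (g x)) (x : M) : g (e.symm x) = e.symm (g x) := by
    rw [LinearEquiv.eq_symm_apply, ← h, e.apply_symm_apply]
  let p := LinearEquiv.ofBijective P hP
  let q := LinearEquiv.ofBijective Q hQ
  have hp (x) : p x = G (F x) - dA (H x) - H (dA x) := by
    rw [hGF]; change P x = _; abel
  have hq (y) : q y = F (G y) - dB (X y) - X (dB y) := by
    rw [hFG]; change Q y = _; abel
  have hpd := commute_symm (g := dA) p fun x => by
    simp only [hp, map_sub, hGd, hFd, hdA, map_zero]; abel
  have hpχ := commute_symm (g := χA) p fun x => by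
    simp only [hp, map_sub, hGχ, hFχ, hχA, hH, map_neg]; abel
  have hqd := commute_symm (g := dB) q fun x => by
    simp only [hq, map_sub, hGd, hFd, hdB, map_zero]; abel
  have hqχ := commute_symm (g := χB) q fun x => by
    simp only [hq, map_sub, hGχ, hFχ, hχB, hX, map_neg]; abel
  have hLF (x) : p.symm (G (F x)) = x + dA (p.symm (H x)) + p.symm (H (dA x)) := by
    rw [hpd, LinearEquiv.symm_apply_eq, map_add, map_add, p.apply_symm_apply, p.apply_symm_apply,
      hp]
    abel
  have hFR (y) : F (G (q.symm y)) = y + dB (X (q.symm y)) + X (q.symm (dB y)) := by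
    have := hq (q.symm y)
    rw [q.apply_symm_apply, hqd] at this
    nth_rewrite 2 [this]; abel
  refine ⟨p.symm.toLinearMap ∘ₗ G, p.symm.toLinearMap ∘ₗ H,
    X ∘ₗ q.symm.toLinearMap - F ∘ₗ p.symm.toLinearMap ∘ₗ G ∘ₗ X ∘ₗ q.symm.toLinearMap +
      F ∘ₗ p.symm.toLinearMap ∘ₗ H ∘ₗ G ∘ₗ q.symm.toLinearMap, ?_, ?_, ?_, ?_, ?_, ?_⟩
  · intro y; simp [hpd, hGd]
  · intro y; simp [hpχ, hGχ]
  · intro x; simp [hLF]; abel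
  · intro x; simp [hpχ, hH]
  · intro y
    have h₁ := congrArg (fun z => F (p.symm (G z))) (hFR y)
    have h₂ := congrArg F (hLF (G (q.symm y)))
    have h₃ := hFR y
    simp only [map_add, hFd, hGd, hpd, hqd, LinearMap.add_apply, LinearMap.sub_apply,
      LinearMap.comp_apply, LinearEquiv.coe_coe, map_sub] at h₁ h₂ h₃ ⊢
    simp only [← hFd, ← hGd, ← hpd] at h₁ h₂ h₃ ⊢
    grind
  · intro y; simp [hpχ, hH, hX, hGχ, hFχ, hqχ]; abel

/-- The differential `[[−d, 0], [g, d]]` of the mapping cone of `g`. -/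
def coneDiff (dB : B →ₗ[R] B) (dC : C →ₗ[R] C) (g : B →ₗ[R] C) : B × C →ₗ[R] B × C :=
  LinearMap.prod (-(dB ∘ₗ LinearMap.fst R B C))
    (g ∘ₗ LinearMap.fst R B C + dC ∘ₗ LinearMap.snd R B C)

/-- The map `[[−χ, 0], [0, χ]]` on the mapping cone. -/
def coneChi (χB : B →ₗ[R] B) (χC : C →ₗ[R] C) : B × C →ₗ[R] B × C :=
  (-χB).prodMap χC

theorem bijective_of_lower_triangular {P : B →ₗ[R] B} {Q : C →ₗ[R] C} {T : B →ₗ[R] C}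
    (hP : Function.Bijective P) (hQ : Function.Bijective Q) :
    Function.Bijective fun y : B × C => (P y.1, T y.1 + Q y.2) := by
  constructor
  · rintro ⟨b, c⟩ ⟨b', c'⟩ h
    obtain ⟨h₁, h₂⟩ := Prod.mk.inj h
    obtain rfl := hP.1 h₁
    exact Prod.ext rfl (hQ.1 (add_left_cancel h₂))
  · rintro ⟨b, c⟩
    obtain ⟨b', rfl⟩ := hP.2 b
    obtain ⟨c', hc'⟩ := hQ.2 (c - T b')
    exact ⟨(b', c'), by simp [hc']⟩

/-- In an exact triangle `A → B → C → A` of complexes with `χ`-maps, equipped with compatible sign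
involutions, the map `x ↦ (f x, K x)` twisted by the sign is an equivariant homotopy equivalence
from `A` to the mapping cone of `g : B → C`. -/
theorem exists_homotopy_inverse_to_cone {dA χA eA : A →ₗ[R] A} {dB χB eB : B →ₗ[R] B}
    {dC χC eC : C →ₗ[R] C} {f : A →ₗ[R] B} {g : B →ₗ[R] C} {h : C →ₗ[R] A}
    {KA : A →ₗ[R] C} {KB : B →ₗ[R] A} {KC : C →ₗ[R] B}
    {NA : A →ₗ[R] A} {NB : B →ₗ[R] B} {NC : C →ₗ[R] C}
    (hdA : ∀ x, dA (dA x) = 0) (hdB : ∀ x, dB (dB x) = 0) (hdC : ∀ x, dC (dC x) = 0)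
    (hχA : ∀ x, χA (dA x) = -dA (χA x)) (hχB : ∀ x, χB (dB x) = -dB (χB x))
    (hχC : ∀ x, χC (dC x) = -dC (χC x))
    (heA : ∀ x, eA (eA x) = x) (heB : ∀ x, eB (eB x) = x) (heC : ∀ x, eC (eC x) = x)
    (heAd : ∀ x, eA (dA x) = -dA (eA x)) (heBd : ∀ x, eB (dB x) = -dB (eB x))
    (heCd : ∀ x, eC (dC x) = -dC (eC x)) (heAχ : ∀ x, eA (χA x) = -χA (eA x))
    (heBχ : ∀ x, eB (χB x) = -χB (eB x)) (heCχ : ∀ x, eC (χC x) = -χC (eC x))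
    (hfd : ∀ x, dB (f x) = f (dA x)) (hgd : ∀ x, dC (g x) = g (dB x))
    (hhd : ∀ x, dA (h x) = h (dC x)) (hfχ : ∀ x, χB (f x) = f (χA x))
    (hgχ : ∀ x, χC (g x) = g (χB x)) (hhχ : ∀ x, χA (h x) = h (χC x))
    (hKA : ∀ x, dC (KA x) + KA (dA x) + g (f x) = 0)
    (hKB : ∀ x, dA (KB x) + KB (dB x) + h (g x) = 0)
    (hKC : ∀ x, dB (KC x) + KC (dC x) + f (h x) = 0)
    (hKAχ : ∀ x, χC (KA x) = -KA (χA x)) (hKBχ : ∀ x, χA (KB x) = -KB (χB x))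
    (hKCχ : ∀ x, χB (KC x) = -KC (χC x))
    (hNAχ : ∀ x, χA (NA x) = NA (χA x)) (hNBχ : ∀ x, χB (NB x) = NB (χB x))
    (hNCχ : ∀ x, χC (NC x) = NC (χC x))
    (hNA : Function.Bijective ⇑(dA ∘ₗ NA - NA ∘ₗ dA + (h ∘ₗ KA - KB ∘ₗ f)))
    (hNB : Function.Bijective ⇑(dB ∘ₗ NB - NB ∘ₗ dB + (f ∘ₗ KB - KC ∘ₗ g)))
    (hNC : Function.Bijective ⇑(dC ∘ₗ NC - NC ∘ₗ dC + (g ∘ₗ KC - KA ∘ₗ h)))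
    (heKB : ∀ x, eA (KB x) = KB (eB x)) (heh : ∀ x, eA (h x) = h (eC x))
    (heg : ∀ x, eC (g x) = -g (eB x)) :
    (∀ x, coneDiff dB dC g (f (eA x), KA (eA x)) = (f (eA (dA x)), KA (eA (dA x)))) ∧
    (∀ x, coneChi χB χC (f (eA x), KA (eA x)) = (f (eA (χA x)), KA (eA (χA x)))) ∧
    ∃ (L : B × C →ₗ[R] A) (H₁ : A →ₗ[R] A) (H₂ : B × C →ₗ[R] B × C),
      (∀ y, dA (L y) = L (coneDiff dB dC g y)) ∧ (∀ y, χA (L y) = L (coneChi χB χC y)) ∧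
      (∀ x, dA (H₁ x) + H₁ (dA x) = L (f (eA x), KA (eA x)) - x) ∧
      (∀ x, χA (H₁ x) = -H₁ (χA x)) ∧
      (∀ y, coneDiff dB dC g (H₂ y) + H₂ (coneDiff dB dC g y) =
        (f (eA (L y)), KA (eA (L y))) - y) ∧
      (∀ y, coneChi χB χC (H₂ y) = -H₂ (coneChi χB χC y)) := by
  have hKA' (x) : dC (KA x) = -KA (dA x) - g (f x) := by rw [← sub_eq_zero, ← hKA x]; abel
  have hKB' (x) : dA (KB x) = -KB (dB x) - h (g x) := by rw [← sub_eq_zero, ← hKB x]; abel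
  have hKC' (x) : dB (KC x) = -KC (dC x) - f (h x) := by rw [← sub_eq_zero, ← hKC x]; abel
  have bij {M : Type u} [AddCommGroup M] [Module R M] {e : M →ₗ[R] M} (he : ∀ x, e (e x) = x) :
      Function.Bijective e := Function.Involutive.bijective he
  have hFd : ∀ x, coneDiff dB dC g (f (eA x), KA (eA x)) = (f (eA (dA x)), KA (eA (dA x))) := by
    intro x
    refine Prod.ext ?_ ?_
    · simp [coneDiff, hfd, heAd]
    · simp [coneDiff, hKA', heAd]
  have hFχ : ∀ x, coneChi χB χC (f (eA x), KA (eA x)) = (f (eA (χA x)), KA (eA (χA x))) := by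
    intro x
    simp [coneChi, hfχ, heAχ, hKAχ]
  refine ⟨hFd, hFχ, ?_⟩
  let T : B →ₗ[R] C := g ∘ₗ NB + NC ∘ₗ g - KA ∘ₗ KB
  let Q : B × C →ₗ[R] B × C :=
    LinearMap.prod
      (-((dB ∘ₗ NB - NB ∘ₗ dB + (f ∘ₗ KB - KC ∘ₗ g)) ∘ₗ eB ∘ₗ LinearMap.fst R B C))
      (T ∘ₗ eB ∘ₗ LinearMap.fst R B C -
        (dC ∘ₗ NC - NC ∘ₗ dC + (g ∘ₗ KC - KA ∘ₗ h)) ∘ₗ eC ∘ₗ LinearMap.snd R B C)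
  let X : B × C →ₗ[R] B × C :=
    LinearMap.prod (KC ∘ₗ eC ∘ₗ LinearMap.snd R B C - NB ∘ₗ eB ∘ₗ LinearMap.fst R B C)
      (NC ∘ₗ eC ∘ₗ LinearMap.snd R B C)
  refine exists_equivariant_homotopy_inverse (F := (f ∘ₗ eA).prod (KA ∘ₗ eA))
    (G := h ∘ₗ LinearMap.snd R B C - KB ∘ₗ LinearMap.fst R B C) (H := -(NA ∘ₗ eA))
    (P := (dA ∘ₗ NA - NA ∘ₗ dA + (h ∘ₗ KA - KB ∘ₗ f)) ∘ₗ eA) (Q := Q) (X := X)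
    hdA ?_ hχA ?_ hFd hFχ ?_ ?_ ?_ ?_ ?_ ?_ ?_ ?_
  · rintro ⟨b, c⟩; simp [coneDiff, hdB, hdC, hgd]
  · rintro ⟨b, c⟩; simp [coneDiff, coneChi, hχB, hχC, hgχ, add_comm]
  · rintro ⟨b, c⟩; simp [coneDiff, hKB', hhd]; abel
  · rintro ⟨b, c⟩; simp [coneChi, hKBχ, hhχ]
  · exact hNA.comp (bij heA)
  · have neg_bij {M N : Type u} [AddCommGroup M] [AddCommGroup N] {k : M → N}
        (hk : Function.Bijective k) : Function.Bijective fun x => -k x :=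
      (Equiv.neg N).bijective.comp hk
    have := bijective_of_lower_triangular
      (P := -((dB ∘ₗ NB - NB ∘ₗ dB + (f ∘ₗ KB - KC ∘ₗ g)) ∘ₗ eB))
      (Q := -((dC ∘ₗ NC - NC ∘ₗ dC + (g ∘ₗ KC - KA ∘ₗ h)) ∘ₗ eC)) (T := T ∘ₗ eB)
      (neg_bij (hNB.comp (bij heB))) (neg_bij (hNC.comp (bij heC)))
    convert this using 1
    ext ⟨b, c⟩ <;> simp [Q, sub_eq_add_neg]
  · intro x; simp [heAd]; abel
  · intro x; simp [hNAχ, heAχ]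
  · rintro ⟨b, c⟩
    refine Prod.ext ?_ ?_
    · simp [Q, X, T, coneDiff, heKB, heh, heg, heBd, heCd, hKC']; abel
    · simp [Q, X, T, coneDiff, heKB, heh, heg, heBd, heCd, hKC']; abel
  · rintro ⟨b, c⟩
    refine Prod.ext ?_ ?_
    · simp [X, coneChi, heBχ, heCχ, hNBχ, hNCχ, hKCχ]
    · simp [X, coneChi, heBχ, heCχ, hNBχ, hNCχ, hKCχ]

end EquivariantComplexes


namespace GradedMod

/-- A grading along which linear maps can be glued uniquely from their restrictions to the
homogeneous pieces. -/
def IsGluable (M : GradedMod R) : Prop :=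
  ∀ (N : Type u) [AddCommGroup N] [Module R N] (g : ℤ → M.carrier →ₗ[R] N),
    ∃! T : M.carrier →ₗ[R] N, ∀ i, ∀ x ∈ M.grading i, T x = g i x

variable {M N P : GradedMod R}

theorem IsFGFree.isGluable (hM : M.IsFGFree) : M.IsGluable := by
  classical
  intro N _ _ g
  let e := LinearEquiv.ofBijective (DirectSum.coeLinearMap M.grading) hM.1
  have he (i : ℤ) (x : M.grading i) : e.symm x = DirectSum.lof R ℤ (fun i => M.grading i) i x := by
    rw [LinearEquiv.symm_apply_eq]
    exact (DirectSum.coeLinearMap_lof M.grading i x).symm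
  refine ⟨DirectSum.toModule R ℤ N (fun i => g i ∘ₗ (M.grading i).subtype) ∘ₗ e.symm.toLinearMap,
    fun i x hx => ?_, fun T hT => ?_⟩
  · simp [he i ⟨x, hx⟩]
  · refine LinearMap.ext fun y => ?_
    obtain ⟨z, rfl⟩ := e.surjective y
    suffices T ∘ₗ e.toLinearMap = DirectSum.toModule R ℤ N fun i => g i ∘ₗ (M.grading i).subtype by
      simpa using LinearMap.congr_fun this z
    refine DirectSum.linearMap_ext R fun i => LinearMap.ext fun x => ?_
    have : e (DirectSum.lof R ℤ (fun i => M.grading i) i x) = x :=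
      DirectSum.coeLinearMap_lof M.grading i x
    simp [this, hT i x x.2]

theorem IsGluable.reindex (hM : M.IsGluable) (σ : ℤ ≃ ℤ) :
    IsGluable (R := R) { carrier := M.carrier, grading := fun j => M.grading (σ j) } := by
  intro N _ _ g
  obtain ⟨T, hT, hT'⟩ := hM N fun i => g (σ.symm i)
  refine ⟨T, fun i x hx => by simpa using hT _ x hx, fun S hS => hT' S fun i x hx => ?_⟩
  exact hS (σ.symm i) x (by simpa using hx)

theorem IsGluable.prod (hM : M.IsGluable) (hN : N.IsGluable) : (M.prodGM N).IsGluable := by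
  intro L _ _ g
  obtain ⟨S, hS, hS'⟩ := hM L fun i => g i ∘ₗ LinearMap.inl R M.carrier N.carrier
  obtain ⟨T, hT, hT'⟩ := hN L fun i => g i ∘ₗ LinearMap.inr R M.carrier N.carrier
  refine ⟨S.coprod T, ?_, fun U hU => ?_⟩
  · rintro i ⟨x, y⟩ ⟨hx, hy⟩
    have h := map_add (g i) ((x, 0) : M.carrier × N.carrier) ((0, y) : M.carrier × N.carrier)
    have hS := hS i x hx
    have hT := hT i y hy
    change S x + T y = _
    rw [hS, hT]
    refine h.symm.trans (congrArg (g i) ?_)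
    exact Prod.ext (add_zero x) (zero_add y)
  · have h₁ := hS' (U ∘ₗ LinearMap.inl R M.carrier N.carrier) fun i x hx =>
      hU i (x, 0) ⟨hx, zero_mem _⟩
    have h₂ := hT' (U ∘ₗ LinearMap.inr R M.carrier N.carrier) fun i y hy =>
      hU i (0, y) ⟨zero_mem _, hy⟩
    rw [← h₁, ← h₂]
    exact (LinearMap.coprod_comp_inl_inr U).symm

theorem IsGluable.hom_ext (hM : M.IsGluable) {L : Type u} [AddCommGroup L] [Module R L]
    {S T : M.carrier →ₗ[R] L} (h : ∀ i, ∀ x ∈ M.grading i, S x = T x) : S = T :=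
  (hM L fun _ => T).unique h fun _ _ _ => rfl

/-- The projection to the homogeneous piece of degree `j`. -/
noncomputable def IsGluable.proj (hM : M.IsGluable) (j : ℤ) : M.carrier →ₗ[R] M.carrier :=
  (hM M.carrier fun i => if i = j then LinearMap.id else 0).choose

theorem IsGluable.proj_apply (hM : M.IsGluable) {i : ℤ} (j : ℤ) {x : M.carrier}
    (hx : x ∈ M.grading i) : hM.proj j x = if i = j then x else 0 := by
  rw [IsGluable.proj, (hM M.carrier fun i => if i = j then LinearMap.id else 0).choose_spec.1 i x hx]
  split_ifs <;> rfl

theorem IsGluable.proj_mem (hM : M.IsGluable) (j : ℤ) (x : M.carrier) :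
    hM.proj j x ∈ M.grading j := by
  have h : (M.grading j).mkQ ∘ₗ hM.proj j = 0 := hM.hom_ext fun i x hx => by
    rw [LinearMap.comp_apply, hM.proj_apply j hx]
    split_ifs with hij
    · subst hij
      simpa using hx
    · simp
  simpa using LinearMap.congr_fun h x

theorem IsDeg.apply_mem {k : ℤ} {f : M.carrier →ₗ[R] N.carrier} (hf : M.IsDeg N k f) {i : ℤ}
    {x : M.carrier} (hx : x ∈ M.grading i) : f x ∈ N.grading (i + k) :=
  hf i (Submodule.mem_map_of_mem hx)

theorem IsGluable.proj_comm (hM : M.IsGluable) (hN : N.IsGluable) {k : ℤ}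
    {f : M.carrier →ₗ[R] N.carrier} (hf : M.IsDeg N k f) (j : ℤ) (x : M.carrier) :
    hN.proj (j + k) (f x) = f (hM.proj j x) := by
  have h : hN.proj (j + k) ∘ₗ f = f ∘ₗ hM.proj j := hM.hom_ext fun i x hx => by
    simp only [LinearMap.comp_apply, hM.proj_apply j hx, hN.proj_apply _ (hf.apply_mem hx),
      add_left_inj]
    split_ifs <;> simp
  exact LinearMap.congr_fun h x

/-- The degree `k` part of a linear map between graded modules. -/
noncomputable def IsGluable.part (hM : M.IsGluable) (hN : N.IsGluable) (k : ℤ)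
    (T : M.carrier →ₗ[R] N.carrier) : M.carrier →ₗ[R] N.carrier :=
  (hM N.carrier fun i => hN.proj (i + k) ∘ₗ T).choose

theorem IsGluable.part_apply (hM : M.IsGluable) (hN : N.IsGluable) (k : ℤ)
    (T : M.carrier →ₗ[R] N.carrier) {i : ℤ} {x : M.carrier} (hx : x ∈ M.grading i) :
    hM.part hN k T x = hN.proj (i + k) (T x) :=
  (hM N.carrier fun i => hN.proj (i + k) ∘ₗ T).choose_spec.1 i x hx

theorem IsGluable.isDeg_part (hM : M.IsGluable) (hN : N.IsGluable) (k : ℤ)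
    (T : M.carrier →ₗ[R] N.carrier) : M.IsDeg N k (hM.part hN k T) := by
  rintro i _ ⟨x, hx, rfl⟩
  rw [hM.part_apply hN k T hx]
  exact hN.proj_mem _ _

theorem IsGluable.part_comp_left (hM : M.IsGluable) (hN : N.IsGluable) (hP : P.IsGluable)
    {k l m : ℤ} {g : N.carrier →ₗ[R] P.carrier} (hg : N.IsDeg P l g) (hm : k + l = m)
    (T : M.carrier →ₗ[R] N.carrier) : hM.part hP m (g ∘ₗ T) = g ∘ₗ hM.part hN k T := by
  subst hm
  refine hM.hom_ext fun i x hx => ?_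
  rw [hM.part_apply hP _ _ hx, LinearMap.comp_apply, LinearMap.comp_apply, hM.part_apply hN k T hx,
    ← add_assoc, hN.proj_comm hP hg]

theorem IsGluable.part_comp_right (hM : M.IsGluable) (hN : N.IsGluable) (hP : P.IsGluable)
    {k l m : ℤ} {f : M.carrier →ₗ[R] N.carrier} (hf : M.IsDeg N l f) (hm : l + k = m)
    (T : N.carrier →ₗ[R] P.carrier) : hM.part hP m (T ∘ₗ f) = hN.part hP k T ∘ₗ f := by
  subst hm
  refine hM.hom_ext fun i x hx => ?_
  rw [hM.part_apply hP _ _ hx, LinearMap.comp_apply, LinearMap.comp_apply,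
    hN.part_apply hP k T (hf.apply_mem hx), add_assoc]

theorem IsGluable.part_add (hM : M.IsGluable) (hN : N.IsGluable) (k : ℤ)
    (S T : M.carrier →ₗ[R] N.carrier) :
    hM.part hN k (S + T) = hM.part hN k S + hM.part hN k T :=
  hM.hom_ext fun i x hx => by simp [hM.part_apply hN k _ hx]

theorem IsGluable.part_neg (hM : M.IsGluable) (hN : N.IsGluable) (k : ℤ)
    (T : M.carrier →ₗ[R] N.carrier) : hM.part hN k (-T) = -hM.part hN k T :=
  hM.hom_ext fun i x hx => by simp [hM.part_apply hN k _ hx]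

theorem IsGluable.part_sub_id (hM : M.IsGluable) (T : M.carrier →ₗ[R] M.carrier) :
    hM.part hM 0 (T - LinearMap.id) = hM.part hM 0 T - LinearMap.id :=
  hM.hom_ext fun i x hx => by simp [hM.part_apply hM 0 _ hx, hM.proj_apply i hx]

/-- The sign operator, acting on the degree `i` piece by `(-1)^i`. -/
noncomputable def IsGluable.sign (hM : M.IsGluable) : M.carrier →ₗ[R] M.carrier :=
  (hM M.carrier fun i => (i.negOnePow : ℤ) • LinearMap.id).choose

theorem IsGluable.sign_apply (hM : M.IsGluable) {i : ℤ} {x : M.carrier} (hx : x ∈ M.grading i) :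
    hM.sign x = (i.negOnePow : ℤ) • x :=
  (hM M.carrier fun i => (i.negOnePow : ℤ) • LinearMap.id).choose_spec.1 i x hx

theorem IsGluable.isDeg_sign (hM : M.IsGluable) : M.IsDeg M 0 hM.sign := by
  rintro i _ ⟨x, hx, rfl⟩
  rw [hM.sign_apply hx, add_zero]
  exact zsmul_mem hx _

theorem IsGluable.sign_sign (hM : M.IsGluable) (x : M.carrier) : hM.sign (hM.sign x) = x := by
  have h : hM.sign ∘ₗ hM.sign = LinearMap.id := hM.hom_ext fun i x hx => by
    rw [LinearMap.comp_apply, hM.sign_apply hx, map_zsmul, hM.sign_apply hx, smul_smul,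
      ← Units.val_mul, Int.units_mul_self]
    simp
  exact LinearMap.congr_fun h x

theorem IsGluable.sign_comm (hM : M.IsGluable) (hN : N.IsGluable) {k : ℤ}
    {f : M.carrier →ₗ[R] N.carrier} (hf : M.IsDeg N k f) (x : M.carrier) :
    hN.sign (f x) = (k.negOnePow : ℤ) • f (hM.sign x) := by
  have h : hN.sign ∘ₗ f = (k.negOnePow : ℤ) • f ∘ₗ hM.sign := hM.hom_ext fun i x hx => by
    simp only [LinearMap.comp_apply, LinearMap.smul_apply, hM.sign_apply hx,
      hN.sign_apply (hf.apply_mem hx), map_zsmul, smul_smul, Int.negOnePow_add, Units.val_mul,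
      mul_comm]
  exact LinearMap.congr_fun h x

end GradedMod

theorem GradedMod.IsDeg.apply_mem_of_eq {M N : GradedMod R} {k i j : ℤ}
    {f : M.carrier →ₗ[R] N.carrier} (hf : M.IsDeg N k f) {x : M.carrier} (hx : x ∈ M.grading i)
    (hj : i + k = j) : f x ∈ N.grading j :=
  hj ▸ hf.apply_mem hx

namespace SCData

variable {S T : SCData R}

/-- The element of `C ⊕ C[-1] ⊕ 𝖱` with the given components. -/
def mkTot (S : SCData R) (c c' : S.Irr.carrier) (ρ : S.Red.carrier) : S.Tot.carrier := (c, c', ρ)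

theorem exists_mkTot (x : S.Tot.carrier) : ∃ c c' ρ, x = S.mkTot c c' ρ :=
  ⟨x.1, x.2.1, x.2.2, rfl⟩

theorem totalDiff_mkTot (c c' : S.Irr.carrier) (ρ : S.Red.carrier) :
    S.totalDiff (S.mkTot c c' ρ) =
      S.mkTot (S.d c) (S.v c - S.d c' + S.δ₂ ρ) (S.δ₁ c + S.r ρ) := rfl

theorem totalChi_mkTot (c c' : S.Irr.carrier) (ρ : S.Red.carrier) :
    S.totalChi (S.mkTot c c' ρ) = S.mkTot 0 c 0 := rfl

theorem morTotal_mkTot (f : SMap S T) (c c' : S.Irr.carrier) (ρ : S.Red.carrier) :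
    morTotal f (S.mkTot c c' ρ) =
      T.mkTot (f.lam c) (f.mu c + f.lam c' + f.del2 ρ) (f.del1 c + f.rho ρ) := rfl

theorem htpTotal_mkTot (f : SMap S T) (c c' : S.Irr.carrier) (ρ : S.Red.carrier) :
    htpTotal f (S.mkTot c c' ρ) =
      T.mkTot (f.lam c) (f.mu c - f.lam c' + f.del2 ρ) (f.del1 c + f.rho ρ) := rfl

theorem mkTot_add (c₁ c₂ c₁' c₂' : S.Irr.carrier) (ρ₁ ρ₂ : S.Red.carrier) :
    S.mkTot c₁ c₁' ρ₁ + S.mkTot c₂ c₂' ρ₂ = S.mkTot (c₁ + c₂) (c₁' + c₂') (ρ₁ + ρ₂) := rfl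

theorem mkTot_neg (c c' : S.Irr.carrier) (ρ : S.Red.carrier) :
    -S.mkTot c c' ρ = S.mkTot (-c) (-c') (-ρ) := rfl

theorem mkTot_sub (c₁ c₂ c₁' c₂' : S.Irr.carrier) (ρ₁ ρ₂ : S.Red.carrier) :
    S.mkTot c₁ c₁' ρ₁ - S.mkTot c₂ c₂' ρ₂ = S.mkTot (c₁ - c₂) (c₁' - c₂') (ρ₁ - ρ₂) := rfl

theorem mkTot_zero : S.mkTot 0 0 0 = 0 := rfl

theorem mkTot_inj {c₁ c₂ c₁' c₂' : S.Irr.carrier} {ρ₁ ρ₂ : S.Red.carrier} :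
    S.mkTot c₁ c₁' ρ₁ = S.mkTot c₂ c₂' ρ₂ ↔ c₁ = c₂ ∧ c₁' = c₂' ∧ ρ₁ = ρ₂ := by
  constructor
  · intro h
    exact ⟨congrArg Prod.fst h, congrArg (fun x => x.2.1) h, congrArg (fun x => x.2.2) h⟩
  · rintro ⟨rfl, rfl, rfl⟩; rfl

theorem mkTot_mem_grading {j : ℤ} {c c' : S.Irr.carrier} {ρ : S.Red.carrier} :
    S.mkTot c c' ρ ∈ S.Tot.grading j ↔
      c ∈ S.Irr.grading j ∧ c' ∈ S.Irr.grading (j - 1) ∧ ρ ∈ S.Red.grading j := Iff.rfl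

theorem Relations.totalDiff_totalDiff (hS : S.Relations) (x : S.Tot.carrier) :
    S.totalDiff (S.totalDiff x) = 0 := by
  obtain ⟨h₁, h₂, h₃, h₄, h₅⟩ := hS
  obtain ⟨c, c', ρ, rfl⟩ := exists_mkTot x
  replace h₁ (c) := LinearMap.congr_fun h₁ c
  replace h₂ := LinearMap.congr_fun h₂ c
  replace h₃ := LinearMap.congr_fun h₃ ρ
  replace h₄ := LinearMap.congr_fun h₄ c
  replace h₅ := LinearMap.congr_fun h₅ ρ
  simp only [LinearMap.comp_apply, LinearMap.add_apply, LinearMap.sub_apply,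
    LinearMap.zero_apply] at h₁ h₂ h₃ h₄ h₅
  simp only [totalDiff_mkTot, ← mkTot_zero, mkTot_inj, map_add, map_sub, h₁, h₅]
  refine ⟨trivial, ?_, ?_⟩ <;> grind

theorem totalChi_totalDiff (x : S.Tot.carrier) :
    S.totalChi (S.totalDiff x) = -S.totalDiff (S.totalChi x) := by
  obtain ⟨c, c', ρ, rfl⟩ := exists_mkTot x
  simp [totalDiff_mkTot, totalChi_mkTot, mkTot_neg]

theorem totalChi_morTotal (f : SMap S T) (x : S.Tot.carrier) :
    T.totalChi (morTotal f x) = morTotal f (S.totalChi x) := by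
  obtain ⟨c, c', ρ, rfl⟩ := exists_mkTot x
  simp [morTotal_mkTot, totalChi_mkTot]

theorem totalChi_htpTotal (f : SMap S T) (x : S.Tot.carrier) :
    T.totalChi (htpTotal f x) = -htpTotal f (S.totalChi x) := by
  obtain ⟨c, c', ρ, rfl⟩ := exists_mkTot x
  simp [htpTotal_mkTot, totalChi_mkTot, mkTot_neg]

theorem isDeg_totalChi : S.Tot.IsDeg S.Tot 1 S.totalChi := by
  rintro i _ ⟨⟨c, c', ρ⟩, hx, rfl⟩
  obtain ⟨hc, -, -⟩ := mkTot_mem_grading.1 hx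
  refine mkTot_mem_grading.2 ⟨zero_mem _, ?_, zero_mem _⟩
  rwa [add_sub_cancel_right]

theorem Degrees.isDeg_totalDiff (hS : S.Degrees) : S.Tot.IsDeg S.Tot (-1) S.totalDiff := by
  obtain ⟨h₁, h₂, h₃, h₄, h₅⟩ := hS
  rintro i _ ⟨⟨c, c', ρ⟩, hx, rfl⟩
  obtain ⟨hc, hc', hρ⟩ := mkTot_mem_grading.1 hx
  exact mkTot_mem_grading.2 ⟨h₁.apply_mem hc,
    add_mem (sub_mem (h₂.apply_mem_of_eq hc (by ring)) (h₁.apply_mem_of_eq hc' (by ring)))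
      (h₄.apply_mem_of_eq hρ (by ring)), add_mem (h₃.apply_mem hc) (h₅.apply_mem hρ)⟩

theorem isGluable_tot (hI : S.Irr.IsGluable) (hR : S.Red.IsGluable) : S.Tot.IsGluable :=
  hI.prod ((hI.reindex (Equiv.subRight 1)).prod hR)

theorem isMor_iff {f : SMap S T} :
    f.IsMor ↔ ∀ x, T.totalDiff (morTotal f x) = morTotal f (S.totalDiff x) := by
  constructor
  · rintro ⟨h₁, h₂, h₃, h₄, h₅⟩ x
    obtain ⟨c, c', ρ, rfl⟩ := exists_mkTot x
    have h₁' := LinearMap.congr_fun h₁ c'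
    replace h₁ := LinearMap.congr_fun h₁ c
    replace h₂ := LinearMap.congr_fun h₂ c
    replace h₃ := LinearMap.congr_fun h₃ ρ
    replace h₄ := LinearMap.congr_fun h₄ c
    replace h₅ := LinearMap.congr_fun h₅ ρ
    simp only [LinearMap.comp_apply, LinearMap.add_apply, LinearMap.sub_apply,
      LinearMap.zero_apply] at h₁ h₁' h₂ h₃ h₄ h₅
    simp only [totalDiff_mkTot, morTotal_mkTot, mkTot_inj, map_add, map_sub]
    refine ⟨?_, ?_, ?_⟩ <;> grind
  · intro h
    refine ⟨?_, ?_, ?_, ?_, ?_⟩ <;> refine LinearMap.ext fun x => ?_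
    · have := h (S.mkTot x 0 0)
      simp only [totalDiff_mkTot, morTotal_mkTot, mkTot_inj, map_zero, add_zero, sub_zero] at this
      simp only [LinearMap.comp_apply, LinearMap.sub_apply, LinearMap.zero_apply]
      grind
    · have := h (S.mkTot x 0 0)
      simp only [totalDiff_mkTot, morTotal_mkTot, mkTot_inj, map_zero, add_zero, sub_zero] at this
      simp only [LinearMap.comp_apply, LinearMap.add_apply, LinearMap.sub_apply,
        LinearMap.zero_apply]
      grind
    · have := h (S.mkTot 0 0 x)
      simp only [totalDiff_mkTot, morTotal_mkTot, mkTot_inj, map_zero, zero_add, sub_zero,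
        zero_sub] at this
      simp only [LinearMap.comp_apply, LinearMap.add_apply, LinearMap.sub_apply,
        LinearMap.zero_apply]
      grind
    · have := h (S.mkTot x 0 0)
      simp only [totalDiff_mkTot, morTotal_mkTot, mkTot_inj, map_zero, add_zero, sub_zero] at this
      simp only [LinearMap.comp_apply, LinearMap.add_apply, LinearMap.sub_apply,
        LinearMap.zero_apply]
      grind
    · have := h (S.mkTot 0 0 x)
      simp only [totalDiff_mkTot, morTotal_mkTot, mkTot_inj, map_zero, zero_add, sub_zero,
        zero_sub] at this
      simp only [LinearMap.comp_apply, LinearMap.sub_apply, LinearMap.zero_apply]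
      grind

theorem isHtpyFrom_of_total {K f g : SMap S T}
    (h : ∀ x, T.totalDiff (htpTotal K x) + htpTotal K (S.totalDiff x) =
      morTotal f x - morTotal g x) : K.IsHtpyFrom f g := by
  have h₁ (c : S.Irr.carrier) := h (S.mkTot c 0 0)
  have h₂ (ρ : S.Red.carrier) := h (S.mkTot 0 0 ρ)
  simp only [totalDiff_mkTot, morTotal_mkTot, htpTotal_mkTot, mkTot_inj, mkTot_add, mkTot_sub,
    map_zero, zero_add, add_zero, sub_zero, zero_sub] at h₁ h₂
  clear h
  refine ⟨?_, ?_, ?_, ?_, ?_⟩ <;> refine LinearMap.ext fun x => ?_ <;>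
    simp only [LinearMap.comp_apply, LinearMap.add_apply, LinearMap.sub_apply,
      LinearMap.neg_apply, LinearMap.zero_apply]
  · have := h₁ x
    clear h₁ h₂
    grind
  · have := h₁ x
    clear h₁ h₂
    grind
  · have := h₂ x
    clear h₁ h₂
    grind
  · have := h₁ x
    clear h₁ h₂
    grind
  · have := h₂ x
    clear h₁ h₂
    grind

theorem morTotal_comp {U : SCData R} (g : SMap T U) (f : SMap S T) (x : S.Tot.carrier) :
    morTotal (g.comp f) x = morTotal g (morTotal f x) := by
  obtain ⟨c, c', ρ, rfl⟩ := exists_mkTot x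
  simp only [morTotal_mkTot, mkTot_inj, SMap.comp, LinearMap.comp_apply, LinearMap.add_apply,
    map_add]
  refine ⟨trivial, ?_, ?_⟩ <;> abel

theorem morTotal_idMap (x : S.Tot.carrier) : morTotal (idMap S) x = x := by
  obtain ⟨c, c', ρ, rfl⟩ := exists_mkTot x
  simp [morTotal_mkTot, idMap]

theorem isDeg_morTotal_iff {f : SMap S T} {k : ℤ} :
    S.Tot.IsDeg T.Tot k (morTotal f) ↔ f.DegreesAt k := by
  constructor
  · intro h
    have h₁ (i : ℤ) (c) (hc : c ∈ S.Irr.grading i) :=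
      h.apply_mem (mkTot_mem_grading.2 ⟨hc, zero_mem (S.Irr.grading (i - 1)),
        zero_mem (S.Red.grading i)⟩)
    have h₂ (i : ℤ) (ρ) (hρ : ρ ∈ S.Red.grading i) :=
      h.apply_mem (mkTot_mem_grading.2 ⟨zero_mem (S.Irr.grading i),
        zero_mem (S.Irr.grading (i - 1)), hρ⟩)
    simp only [morTotal_mkTot, mkTot_mem_grading, map_zero, add_zero, zero_add,
      add_sub_assoc] at h₁ h₂
    refine ⟨?_, ?_, ?_, ?_, ?_⟩ <;> rintro i _ ⟨x, hx, rfl⟩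
    exacts [(h₁ i x hx).1, (h₁ i x hx).2.1, (h₁ i x hx).2.2, (h₂ i x hx).2.1, (h₂ i x hx).2.2]
  · rintro ⟨h₁, h₂, h₃, h₄, h₅⟩ i _ ⟨⟨c, c', ρ⟩, hx, rfl⟩
    obtain ⟨hc, hc', hρ⟩ := mkTot_mem_grading.1 hx
    exact mkTot_mem_grading.2 ⟨h₁.apply_mem hc,
      add_mem (add_mem (h₂.apply_mem_of_eq hc (by ring)) (h₁.apply_mem_of_eq hc' (by ring)))
        (h₄.apply_mem_of_eq hρ (by ring)), add_mem (h₃.apply_mem hc) (h₅.apply_mem hρ)⟩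

theorem isDeg_htpTotal_iff {f : SMap S T} {k : ℤ} :
    S.Tot.IsDeg T.Tot k (htpTotal f) ↔ f.DegreesAt k := by
  constructor
  · intro h
    have h₁ (i : ℤ) (c) (hc : c ∈ S.Irr.grading i) :=
      h.apply_mem (mkTot_mem_grading.2 ⟨hc, zero_mem (S.Irr.grading (i - 1)),
        zero_mem (S.Red.grading i)⟩)
    have h₂ (i : ℤ) (ρ) (hρ : ρ ∈ S.Red.grading i) :=
      h.apply_mem (mkTot_mem_grading.2 ⟨zero_mem (S.Irr.grading i),
        zero_mem (S.Irr.grading (i - 1)), hρ⟩)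
    simp only [htpTotal_mkTot, mkTot_mem_grading, map_zero, add_zero, zero_add, sub_zero,
      add_sub_assoc] at h₁ h₂
    refine ⟨?_, ?_, ?_, ?_, ?_⟩ <;> rintro i _ ⟨x, hx, rfl⟩
    exacts [(h₁ i x hx).1, (h₁ i x hx).2.1, (h₁ i x hx).2.2, (h₂ i x hx).2.1, (h₂ i x hx).2.2]
  · rintro ⟨h₁, h₂, h₃, h₄, h₅⟩ i _ ⟨⟨c, c', ρ⟩, hx, rfl⟩
    obtain ⟨hc, hc', hρ⟩ := mkTot_mem_grading.1 hx
    exact mkTot_mem_grading.2 ⟨h₁.apply_mem hc,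
      add_mem (sub_mem (h₂.apply_mem_of_eq hc (by ring)) (h₁.apply_mem_of_eq hc' (by ring)))
        (h₄.apply_mem_of_eq hρ (by ring)), add_mem (h₃.apply_mem hc) (h₅.apply_mem hρ)⟩

/-- The block components of a linear map between total complexes that are relevant for
`χ`-equivariant maps. -/
def blocks (F : S.Tot.carrier →ₗ[R] T.Tot.carrier) : SMap S T where
  lam := pj₁ ∘ₗ F ∘ₗ tri LinearMap.id 0 0
  mu := pj₂ ∘ₗ F ∘ₗ tri LinearMap.id 0 0
  del1 := pj₃ ∘ₗ F ∘ₗ tri LinearMap.id 0 0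
  del2 := pj₂ ∘ₗ F ∘ₗ tri 0 0 LinearMap.id
  rho := pj₃ ∘ₗ F ∘ₗ tri 0 0 LinearMap.id

theorem apply_eq_add (F : S.Tot.carrier →ₗ[R] T.Tot.carrier) (c c' : S.Irr.carrier)
    (ρ : S.Red.carrier) :
    F (S.mkTot c c' ρ) = F (S.mkTot c 0 0) + F (S.totalChi (S.mkTot c' 0 0)) + F (S.mkTot 0 0 ρ) := by
  rw [← map_add, ← map_add, totalChi_mkTot, mkTot_add, mkTot_add]
  simp

theorem apply_red_fst {F : S.Tot.carrier →ₗ[R] T.Tot.carrier}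
    (hF : ∀ x, T.totalChi (F x) = F (S.totalChi x) ∨ T.totalChi (F x) = -F (S.totalChi x))
    (ρ : S.Red.carrier) : (F (S.mkTot 0 0 ρ)).1 = 0 := by
  have h := hF (S.mkTot 0 0 ρ)
  rw [totalChi_mkTot, mkTot_zero, map_zero, neg_zero, or_self] at h
  exact congrArg (fun x => x.2.1) h

theorem morTotal_blocks {F : S.Tot.carrier →ₗ[R] T.Tot.carrier}
    (hF : ∀ x, T.totalChi (F x) = F (S.totalChi x)) : morTotal (blocks F) = F := by
  refine LinearMap.ext fun x => ?_
  obtain ⟨c, c', ρ, rfl⟩ := exists_mkTot x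
  rw [apply_eq_add F, ← hF]
  refine Prod.ext ?_ (Prod.ext ?_ ?_)
  · change (F (S.mkTot c 0 0)).1 = (F (S.mkTot c 0 0)).1 + 0 + (F (S.mkTot 0 0 ρ)).1
    rw [apply_red_fst fun x => .inl (hF x), add_zero, add_zero]
  · rfl
  · change (F (S.mkTot c 0 0)).2.2 + (F (S.mkTot 0 0 ρ)).2.2 = (F (S.mkTot c 0 0)).2.2 + 0 + (F (S.mkTot 0 0 ρ)).2.2
    rw [add_zero]

theorem htpTotal_blocks {F : S.Tot.carrier →ₗ[R] T.Tot.carrier}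
    (hF : ∀ x, T.totalChi (F x) = -F (S.totalChi x)) : htpTotal (blocks F) = F := by
  refine LinearMap.ext fun x => ?_
  obtain ⟨c, c', ρ, rfl⟩ := exists_mkTot x
  rw [apply_eq_add F, ← neg_neg (F (S.totalChi _)), ← hF]
  refine Prod.ext ?_ (Prod.ext ?_ ?_)
  · change (F (S.mkTot c 0 0)).1 = (F (S.mkTot c 0 0)).1 + -0 + (F (S.mkTot 0 0 ρ)).1
    rw [apply_red_fst fun x => .inr (hF x), neg_zero, add_zero, add_zero]
  · change (F (S.mkTot c 0 0)).2.1 - (F (S.mkTot c' 0 0)).1 + (F (S.mkTot 0 0 ρ)).2.1 =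
      (F (S.mkTot c 0 0)).2.1 + -(F (S.mkTot c' 0 0)).1 + (F (S.mkTot 0 0 ρ)).2.1
    rw [sub_eq_add_neg]
  · change (F (S.mkTot c 0 0)).2.2 + (F (S.mkTot 0 0 ρ)).2.2 = (F (S.mkTot c 0 0)).2.2 + -0 + (F (S.mkTot 0 0 ρ)).2.2
    rw [neg_zero, add_zero]

/-- A degree `0` morphism with an equivariant, not necessarily homogeneous, homotopy inverse gives
an `S`-chain homotopy equivalence: take homogeneous parts of the inverse and the homotopies. -/
theorem sHomotopyEquiv_of_total (hS : S.Tot.IsGluable) (hT : T.Tot.IsGluable)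
    (hdS : S.Degrees) (hdT : T.Degrees)
    {F : S.Tot.carrier →ₗ[R] T.Tot.carrier} {L : T.Tot.carrier →ₗ[R] S.Tot.carrier}
    {H₁ : S.Tot.carrier →ₗ[R] S.Tot.carrier} {H₂ : T.Tot.carrier →ₗ[R] T.Tot.carrier}
    (hF : S.Tot.IsDeg T.Tot 0 F)
    (hFd : ∀ x, T.totalDiff (F x) = F (S.totalDiff x))
    (hFχ : ∀ x, T.totalChi (F x) = F (S.totalChi x))
    (hLd : ∀ y, S.totalDiff (L y) = L (T.totalDiff y))
    (hLχ : ∀ y, S.totalChi (L y) = L (T.totalChi y))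
    (hH₁ : ∀ x, S.totalDiff (H₁ x) + H₁ (S.totalDiff x) = L (F x) - x)
    (hH₁χ : ∀ x, S.totalChi (H₁ x) = -H₁ (S.totalChi x))
    (hH₂ : ∀ y, T.totalDiff (H₂ y) + H₂ (T.totalDiff y) = F (L y) - y)
    (hH₂χ : ∀ y, T.totalChi (H₂ y) = -H₂ (T.totalChi y)) :
    SHomotopyEquiv S T := by
  replace hdS := hdS.isDeg_totalDiff
  replace hdT := hdT.isDeg_totalDiff
  have hχS : S.Tot.IsDeg S.Tot 1 S.totalChi := isDeg_totalChi
  have hχT : T.Tot.IsDeg T.Tot 1 T.totalChi := isDeg_totalChi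
  have eLd : S.totalDiff ∘ₗ hT.part hS 0 L = hT.part hS 0 L ∘ₗ T.totalDiff := by
    rw [← hT.part_comp_left hS hS hdS rfl, ← hT.part_comp_right hT hS hdT (add_comm _ _)]
    exact congrArg _ (LinearMap.ext hLd)
  have eLχ : S.totalChi ∘ₗ hT.part hS 0 L = hT.part hS 0 L ∘ₗ T.totalChi := by
    rw [← hT.part_comp_left hS hS hχS rfl, ← hT.part_comp_right hT hS hχT (add_comm _ _)]
    exact congrArg _ (LinearMap.ext hLχ)
  have eH₁ : S.totalDiff ∘ₗ hS.part hS 1 H₁ + hS.part hS 1 H₁ ∘ₗ S.totalDiff =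
      hT.part hS 0 L ∘ₗ F - LinearMap.id := by
    rw [← hS.part_comp_left hS hS hdS rfl, ← hS.part_comp_right hS hS hdS (add_comm _ _),
      ← hS.part_comp_right hT hS hF rfl, ← hS.part_add hS]
    exact (congrArg _ (LinearMap.ext hH₁)).trans (hS.part_sub_id _)
  have eH₂ : T.totalDiff ∘ₗ hT.part hT 1 H₂ + hT.part hT 1 H₂ ∘ₗ T.totalDiff =
      F ∘ₗ hT.part hS 0 L - LinearMap.id := by
    rw [← hT.part_comp_left hT hT hdT rfl, ← hT.part_comp_right hT hT hdT (add_comm _ _),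
      ← hT.part_comp_left hS hT hF rfl, ← hT.part_add hT]
    exact (congrArg _ (LinearMap.ext hH₂)).trans (hT.part_sub_id _)
  have eH₁χ : S.totalChi ∘ₗ hS.part hS 1 H₁ = -(hS.part hS 1 H₁ ∘ₗ S.totalChi) := by
    rw [← hS.part_comp_left hS hS hχS rfl, ← hS.part_comp_right hS hS hχS rfl, ← hS.part_neg hS]
    exact congrArg _ (LinearMap.ext hH₁χ)
  have eH₂χ : T.totalChi ∘ₗ hT.part hT 1 H₂ = -(hT.part hT 1 H₂ ∘ₗ T.totalChi) := by
    rw [← hT.part_comp_left hT hT hχT rfl, ← hT.part_comp_right hT hT hχT rfl, ← hT.part_neg hT]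
    exact congrArg _ (LinearMap.ext hH₂χ)
  have bF := morTotal_blocks hFχ
  have bL := morTotal_blocks (LinearMap.congr_fun eLχ)
  have bH₁ := htpTotal_blocks (LinearMap.congr_fun eH₁χ)
  have bH₂ := htpTotal_blocks (LinearMap.congr_fun eH₂χ)
  refine ⟨blocks F, blocks (hT.part hS 0 L), blocks (hS.part hS 1 H₁), blocks (hT.part hT 1 H₂),
    isMor_iff.2 ?_, isDeg_morTotal_iff.1 ?_, isMor_iff.2 ?_, isDeg_morTotal_iff.1 ?_,
    isDeg_htpTotal_iff.1 ?_, isHtpyFrom_of_total fun x => ?_,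
    isDeg_htpTotal_iff.1 ?_, isHtpyFrom_of_total fun x => ?_⟩
  · rwa [bF]
  · rwa [bF]
  · rw [bL]; exact LinearMap.congr_fun eLd
  · rw [bL]; exact hT.isDeg_part hS 0 L
  · rw [bH₁]; exact hS.isDeg_part hS 1 H₁
  · rw [morTotal_comp, morTotal_idMap, bF, bL, bH₁]; exact LinearMap.congr_fun eH₁ x
  · rw [bH₂]; exact hT.isDeg_part hT 1 H₂
  · rw [morTotal_comp, morTotal_idMap, bF, bL, bH₂]; exact LinearMap.congr_fun eH₂ x

end SCData

namespace SCData

theorem shiftSC_zero (S : SCData R) : S.shiftSC 0 = S := by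
  have h (gI gR) (hI : gI = S.Irr.grading) (hR : gR = S.Red.grading) :
      (⟨⟨S.Irr.carrier, gI⟩, ⟨S.Red.carrier, gR⟩, S.d, S.v, S.δ₁, S.δ₂, S.r⟩ : SCData R) = S := by
    subst hI hR
    rfl
  exact h _ _ (funext fun j => congrArg _ (zero_add j)) (funext fun j => congrArg _ (zero_add j))

variable {A B C : SCData R}

theorem isGluable_coneSC_shiftSC (hB : B.Irr.IsGluable ∧ B.Red.IsGluable)
    (hC : C.Irr.IsGluable ∧ C.Red.IsGluable) (g : SMap B C) (k n : ℤ) :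
    ((coneSC g k).shiftSC n).Tot.IsGluable :=
  isGluable_tot
    ((((hB.1.reindex (Equiv.subRight k)).reindex (Equiv.subRight 1)).prod hC.1).reindex
      (Equiv.addLeft n))
    ((((hB.2.reindex (Equiv.subRight k)).reindex (Equiv.subRight 1)).prod hC.2).reindex
      (Equiv.addLeft n))

theorem Degrees.coneSC_shiftSC (hB : B.Degrees) (hC : C.Degrees) {g : SMap B C} {k : ℤ}
    (hg : g.DegreesAt k) (n : ℤ) : ((coneSC g k).shiftSC n).Degrees := by
  obtain ⟨hB₁, hB₂, hB₃, hB₄, hB₅⟩ := hB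
  obtain ⟨hC₁, hC₂, hC₃, hC₄, hC₅⟩ := hC
  obtain ⟨hg₁, hg₂, hg₃, hg₄, hg₅⟩ := hg
  refine ⟨?_, ?_, ?_, ?_, ?_⟩ <;> rintro i _ ⟨⟨x, y⟩, ⟨hx, hy⟩, rfl⟩
  · exact ⟨neg_mem (hB₁.apply_mem_of_eq hx (by ring)),
      add_mem (hg₁.apply_mem_of_eq hx (by ring)) (hC₁.apply_mem_of_eq hy (by ring))⟩
  · exact ⟨hB₂.apply_mem_of_eq hx (by ring),
      add_mem (hg₂.apply_mem_of_eq hx (by ring)) (hC₂.apply_mem_of_eq hy (by ring))⟩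
  · exact ⟨neg_mem (hB₃.apply_mem_of_eq hx (by ring)),
      add_mem (hg₃.apply_mem_of_eq hx (by ring)) (hC₃.apply_mem_of_eq hy (by ring))⟩
  · exact ⟨hB₄.apply_mem_of_eq hx (by ring),
      add_mem (hg₄.apply_mem_of_eq hx (by ring)) (hC₄.apply_mem_of_eq hy (by ring))⟩
  · exact ⟨neg_mem (hB₅.apply_mem_of_eq hx (by ring)),
      add_mem (hg₅.apply_mem_of_eq hx (by ring)) (hC₅.apply_mem_of_eq hy (by ring))⟩

/-- The underlying module of a shifted cone of `S`-complexes as the product of the underlying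
modules; the sign accounts for the `χ`-map of the cone being `-χ` on the first factor. -/
def coneTotEquiv (g : SMap B C) (k n : ℤ) :
    ((coneSC g k).shiftSC n).Tot.carrier ≃ₗ[R] B.Tot.carrier × C.Tot.carrier where
  toFun x := (B.mkTot x.1.1 (-x.2.1.1) x.2.2.1, C.mkTot x.1.2 x.2.1.2 x.2.2.2)
  invFun y := ((y.1.1, y.2.1), (-y.1.2.1, y.2.2.1), (y.1.2.2, y.2.2.2))
  map_add' x y := by
    refine Prod.ext ?_ rfl
    exact mkTot_inj.2 ⟨rfl, neg_add _ _, rfl⟩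
  map_smul' a x := by
    refine Prod.ext ?_ rfl
    exact mkTot_inj.2 ⟨rfl, (smul_neg _ _).symm, rfl⟩
  left_inv x := Prod.ext rfl (Prod.ext (Prod.ext (neg_neg _) rfl) rfl)
  right_inv y := Prod.ext (mkTot_inj.2 ⟨rfl, neg_neg _, rfl⟩) rfl

theorem coneTotEquiv_totalDiff (g : SMap B C) (k n : ℤ)
    (x : ((coneSC g k).shiftSC n).Tot.carrier) :
    coneTotEquiv g k n (((coneSC g k).shiftSC n).totalDiff x) =
      coneDiff B.totalDiff C.totalDiff (morTotal g) (coneTotEquiv g k n x) := by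
  obtain ⟨⟨b, c⟩, ⟨b', c'⟩, ⟨ρ, σ⟩⟩ := x
  refine Prod.ext (mkTot_inj.2 ⟨?_, ?_, ?_⟩) (mkTot_inj.2 ⟨?_, ?_, ?_⟩)
  · rfl
  · change -(B.v b - -B.d b' + B.δ₂ ρ) = -(B.v b - B.d (-b') + B.δ₂ ρ)
    rw [map_neg]
  · change -B.δ₁ b + -B.r ρ = -(B.δ₁ b + B.r ρ)
    abel
  · rfl
  · change g.mu b + C.v c - (g.lam b' + C.d c') + (g.del2 ρ + C.δ₂ σ) =
      (g.mu b + g.lam (-b') + g.del2 ρ) + (C.v c - C.d c' + C.δ₂ σ)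
    rw [map_neg]
    abel
  · change (g.del1 b + C.δ₁ c) + (g.rho ρ + C.r σ) = (g.del1 b + g.rho ρ) + (C.δ₁ c + C.r σ)
    abel

theorem coneTotEquiv_totalChi (g : SMap B C) (k n : ℤ)
    (x : ((coneSC g k).shiftSC n).Tot.carrier) :
    coneTotEquiv g k n (((coneSC g k).shiftSC n).totalChi x) =
      coneChi B.totalChi C.totalChi (coneTotEquiv g k n x) :=
  Prod.ext (mkTot_inj.2 ⟨neg_zero.symm, rfl, neg_zero.symm⟩) rfl

theorem coneTotEquiv_symm_mem {g : SMap B C} {k n j : ℤ} {y : B.Tot.carrier × C.Tot.carrier}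
    (hB : y.1 ∈ B.Tot.grading (n + j - 1 - k)) (hC : y.2 ∈ C.Tot.grading (n + j)) :
    (coneTotEquiv g k n).symm y ∈ ((coneSC g k).shiftSC n).Tot.grading j := by
  obtain ⟨hB₁, hB₂, hB₃⟩ := hB
  obtain ⟨hC₁, hC₂, hC₃⟩ := hC
  rw [show n + j - 1 - k - 1 = n + (j - 1) - 1 - k by ring] at hB₂
  rw [add_sub_assoc] at hC₂
  exact ⟨⟨hB₁, hC₁⟩, ⟨neg_mem (S := Submodule R B.Irr.carrier) hB₂, hC₂⟩, ⟨hB₃, hC₃⟩⟩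

theorem IsSComplex.isGluable_tot {S : SCData R} (hS : S.IsSComplex) : S.Tot.IsGluable :=
  SCData.isGluable_tot hS.1.isGluable hS.2.1.isGluable

/-- The vertex `A` of an exact triangle `A → B → C → A` of `S`-complexes is `S`-chain homotopy
equivalent to the cone of `g : B → C`, shifted by the degree `n` of the homotopy `A → C`. -/
theorem sHomotopyEquiv_coneSC_shiftSC
    (hA : A.IsSComplex) (hB : B.IsSComplex) (hC : C.IsSComplex)
    {f : SMap A B} {g : SMap B C} {h : SMap C A}
    {KA : SMap A C} {KB : SMap B A} {KC : SMap C B} {k n : ℤ}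
    (hf : f.IsMor) (hg : g.IsMor) (hh : h.IsMor)
    (hfk : f.DegreesAt (n - 1 - k)) (hgk : g.DegreesAt k) (hhk : h.DegreesAt (-n))
    (hKAk : KA.DegreesAt n) (hKBk : KB.DegreesAt (1 + k - n))
    (hKA : C.totalDiff ∘ₗ htpTotal KA + htpTotal KA ∘ₗ A.totalDiff + morTotal (g.comp f) = 0)
    (hKB : A.totalDiff ∘ₗ htpTotal KB + htpTotal KB ∘ₗ B.totalDiff + morTotal (h.comp g) = 0)
    (hKC : B.totalDiff ∘ₗ htpTotal KC + htpTotal KC ∘ₗ C.totalDiff + morTotal (f.comp h) = 0)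
    (hNA : ∃ N : A.Tot.carrier →ₗ[R] A.Tot.carrier, A.totalChi ∘ₗ N = N ∘ₗ A.totalChi ∧
      Function.Bijective ⇑(A.totalDiff ∘ₗ N - N ∘ₗ A.totalDiff +
        (morTotal h ∘ₗ htpTotal KA - htpTotal KB ∘ₗ morTotal f)))
    (hNB : ∃ N : B.Tot.carrier →ₗ[R] B.Tot.carrier, B.totalChi ∘ₗ N = N ∘ₗ B.totalChi ∧
      Function.Bijective ⇑(B.totalDiff ∘ₗ N - N ∘ₗ B.totalDiff +
        (morTotal f ∘ₗ htpTotal KB - htpTotal KC ∘ₗ morTotal g)))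
    (hNC : ∃ N : C.Tot.carrier →ₗ[R] C.Tot.carrier, C.totalChi ∘ₗ N = N ∘ₗ C.totalChi ∧
      Function.Bijective ⇑(C.totalDiff ∘ₗ N - N ∘ₗ C.totalDiff +
        (morTotal g ∘ₗ htpTotal KC - htpTotal KA ∘ₗ morTotal h))) :
    SHomotopyEquiv A ((coneSC g k).shiftSC n) := by
  obtain ⟨NA, hNAχ, hNA⟩ := hNA
  obtain ⟨NB, hNBχ, hNB⟩ := hNB
  obtain ⟨NC, hNCχ, hNC⟩ := hNC
  have gA := hA.isGluable_tot
  have gB := hB.isGluable_tot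
  have gC := hC.isGluable_tot
  have htpEq {X Y Z : SCData R} {K : SMap X Z} {a : SMap X Y} {b : SMap Y Z}
      (hK : Z.totalDiff ∘ₗ htpTotal K + htpTotal K ∘ₗ X.totalDiff + morTotal (b.comp a) = 0)
      (x : X.Tot.carrier) : Z.totalDiff (htpTotal K x) + htpTotal K (X.totalDiff x) +
        morTotal b (morTotal a x) = 0 := by
    rw [← morTotal_comp]
    exact LinearMap.congr_fun hK x
  have twist_twist {X : SCData R} (gX : X.Tot.IsGluable) (u : ℤˣ) (x : X.Tot.carrier) :
      ((u : ℤ) • gX.sign) (((u : ℤ) • gX.sign) x) = x := by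
    rw [LinearMap.smul_apply, LinearMap.smul_apply, map_zsmul, gX.sign_sign, smul_smul,
      ← Units.val_mul, Int.units_mul_self, Units.val_one, one_smul]
  have sign_diff {X : SCData R} (hX : X.IsSComplex) (gX : X.Tot.IsGluable) (x : X.Tot.carrier) :
      gX.sign (X.totalDiff x) = -X.totalDiff (gX.sign x) := by
    rw [gX.sign_comm gX hX.2.2.1.isDeg_totalDiff]
    simp
  have sign_chi {X : SCData R} (gX : X.Tot.IsGluable) (x : X.Tot.carrier) :
      gX.sign (X.totalChi x) = -X.totalChi (gX.sign x) := by
    rw [gX.sign_comm gX isDeg_totalChi]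
    simp
  have twist_comm {X : SCData R} {gX : X.Tot.IsGluable} (u : ℤˣ)
      {D : X.Tot.carrier →ₗ[R] X.Tot.carrier} (hD : ∀ x, gX.sign (D x) = -D (gX.sign x))
      (x : X.Tot.carrier) : ((u : ℤ) • gX.sign) (D x) = -D (((u : ℤ) • gX.sign) x) := by
    rw [LinearMap.smul_apply, LinearMap.smul_apply, hD, map_zsmul, smul_neg]
  obtain ⟨hFd, hFχ, L, H₁, H₂, hLd, hLχ, hH₁, hH₁χ, hH₂, hH₂χ⟩ :=
    exists_homotopy_inverse_to_cone (eA := gA.sign)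
      (eB := ((1 + k - n).negOnePow : ℤ) • gB.sign) (eC := ((-n).negOnePow : ℤ) • gC.sign)
      hA.2.2.2.totalDiff_totalDiff hB.2.2.2.totalDiff_totalDiff hC.2.2.2.totalDiff_totalDiff
      totalChi_totalDiff totalChi_totalDiff totalChi_totalDiff
      gA.sign_sign (twist_twist gB _) (twist_twist gC _)
      (sign_diff hA gA) (twist_comm _ (sign_diff hB gB)) (twist_comm _ (sign_diff hC gC))
      (sign_chi gA) (twist_comm _ (sign_chi gB)) (twist_comm _ (sign_chi gC))
      (isMor_iff.1 hf) (isMor_iff.1 hg) (isMor_iff.1 hh)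
      (totalChi_morTotal f) (totalChi_morTotal g) (totalChi_morTotal h)
      (htpEq hKA) (htpEq hKB) (htpEq hKC)
      (totalChi_htpTotal KA) (totalChi_htpTotal KB) (totalChi_htpTotal KC)
      (LinearMap.congr_fun hNAχ) (LinearMap.congr_fun hNBχ) (LinearMap.congr_fun hNCχ)
      hNA hNB hNC
      (fun x => by
        rw [gB.sign_comm gA (isDeg_htpTotal_iff.2 hKBk), LinearMap.smul_apply, map_zsmul])
      (fun x => by
        rw [gC.sign_comm gA (isDeg_morTotal_iff.2 hhk), LinearMap.smul_apply, map_zsmul])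
      (fun x => by
        rw [LinearMap.smul_apply, gB.sign_comm gC (isDeg_morTotal_iff.2 hgk),
          LinearMap.smul_apply, map_zsmul, smul_smul, ← neg_smul, ← Units.val_mul,
          ← Int.negOnePow_add, add_sub_assoc, add_comm 1, Int.negOnePow_succ, Units.val_neg,
          neg_neg, neg_add_eq_sub])
  let φ := coneTotEquiv g k n
  have φd (x) : φ (((coneSC g k).shiftSC n).totalDiff x) =
      coneDiff B.totalDiff C.totalDiff (morTotal g) (φ x) := coneTotEquiv_totalDiff g k n x
  have φχ (x) : φ (((coneSC g k).shiftSC n).totalChi x) =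
      coneChi B.totalChi C.totalChi (φ x) := coneTotEquiv_totalChi g k n x
  refine sHomotopyEquiv_of_total
    (F := φ.symm.toLinearMap ∘ₗ (morTotal f ∘ₗ gA.sign).prod (htpTotal KA ∘ₗ gA.sign))
    (L := L ∘ₗ φ.toLinearMap) (H₁ := H₁) (H₂ := φ.symm.toLinearMap ∘ₗ H₂ ∘ₗ φ.toLinearMap)
    gA (isGluable_coneSC_shiftSC ⟨hB.1.isGluable, hB.2.1.isGluable⟩
      ⟨hC.1.isGluable, hC.2.1.isGluable⟩ g k n) hA.2.2.1 (hB.2.2.1.coneSC_shiftSC hC.2.2.1 hgk n)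
    ?_ (fun x => φ.injective ?_) (fun x => φ.injective ?_) (fun y => ?_) (fun y => ?_) (fun x => ?_)
    hH₁χ (fun y => φ.injective ?_) (fun y => φ.injective ?_)
  · rintro j _ ⟨x, hx, rfl⟩
    have hx' := gA.isDeg_sign.apply_mem hx
    exact coneTotEquiv_symm_mem
      ((isDeg_morTotal_iff.2 hfk).apply_mem_of_eq hx' (by ring))
      ((isDeg_htpTotal_iff.2 hKAk).apply_mem_of_eq hx' (by ring))
  · rw [φd]
    simpa using hFd x
  · rw [φχ]
    simpa using hFχ x
  · simp only [LinearMap.comp_apply, LinearEquiv.coe_coe, φd, hLd]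
  · simp only [LinearMap.comp_apply, LinearEquiv.coe_coe, φχ, hLχ]
  · simpa using hH₁ x
  · rw [map_add, φd]
    simpa [φd] using hH₂ (φ y)
  · rw [φχ]
    simpa [φχ] using hH₂χ (φ y)

end SCData

/-- Given an exact triangle of `S`-complexes `C~₀, C~₁, C~₂` with
morphisms `λ~ᵢ : C~ᵢ → C~ᵢ₋₁` (degrees `0, -1, 0` for `i = 0, 1, 2`), homotopies
`K~ᵢ : C~ᵢ → C~ᵢ₋₂` with `d~ᵢ₋₂K~ᵢ + K~ᵢd~ᵢ + λ~ᵢ₋₁λ~ᵢ = 0`, and `χ`-commuting maps `N~ᵢ`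
such that `d~ᵢN~ᵢ − N~ᵢd~ᵢ + λ~ᵢ₋₂K~ᵢ − K~ᵢ₋₁λ~ᵢ` is an isomorphism, there are `S`-chain
homotopy equivalences `C~₀ ≃ Cone(λ~₂)[1]`, `C~₁ ≃ Cone(λ~₀)`, `C~₂ ≃ Cone(λ~₁)`. -/
theorem exact_triangle_cones {R : Type u} [CommRing R] (C0 C1 C2 : SCData R)
    (h0 : C0.IsSComplex) (h1 : C1.IsSComplex) (h2 : C2.IsSComplex)
    (f0 : SMap C0 C2) (f1 : SMap C1 C0) (f2 : SMap C2 C1)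
    (hf0 : f0.IsMor) (hf1 : f1.IsMor) (hf2 : f2.IsMor)
    (hd0 : f0.DegreesAt 0) (hd1 : f1.DegreesAt (-1)) (hd2 : f2.DegreesAt 0)
    (K0 : SMap C0 C1) (K1 : SMap C1 C2) (K2 : SMap C2 C0)
    (hKd0 : K0.DegreesAt 1) (hKd1 : K1.DegreesAt 0) (hKd2 : K2.DegreesAt 0)
    (hK0 : C1.totalDiff ∘ₗ htpTotal K0 + htpTotal K0 ∘ₗ C0.totalDiff +
      morTotal (f2.comp f0) = 0)
    (hK1 : C2.totalDiff ∘ₗ htpTotal K1 + htpTotal K1 ∘ₗ C1.totalDiff +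
      morTotal (f0.comp f1) = 0)
    (hK2 : C0.totalDiff ∘ₗ htpTotal K2 + htpTotal K2 ∘ₗ C2.totalDiff +
      morTotal (f1.comp f2) = 0)
    (hN0 : ∃ N : C0.Tot.carrier →ₗ[R] C0.Tot.carrier,
      C0.totalChi ∘ₗ N = N ∘ₗ C0.totalChi ∧
      Function.Bijective ⇑(C0.totalDiff ∘ₗ N - N ∘ₗ C0.totalDiff +
        (morTotal f1 ∘ₗ htpTotal K0 - htpTotal K2 ∘ₗ morTotal f0)))
    (hN1 : ∃ N : C1.Tot.carrier →ₗ[R] C1.Tot.carrier,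
      C1.totalChi ∘ₗ N = N ∘ₗ C1.totalChi ∧
      Function.Bijective ⇑(C1.totalDiff ∘ₗ N - N ∘ₗ C1.totalDiff +
        (morTotal f2 ∘ₗ htpTotal K1 - htpTotal K0 ∘ₗ morTotal f1)))
    (hN2 : ∃ N : C2.Tot.carrier →ₗ[R] C2.Tot.carrier,
      C2.totalChi ∘ₗ N = N ∘ₗ C2.totalChi ∧
      Function.Bijective ⇑(C2.totalDiff ∘ₗ N - N ∘ₗ C2.totalDiff +
        (morTotal f0 ∘ₗ htpTotal K2 - htpTotal K1 ∘ₗ morTotal f2))) :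
    SHomotopyEquiv C0 ((coneSC f2 0).shiftSC 1) ∧
    SHomotopyEquiv C1 (coneSC f0 0) ∧
    SHomotopyEquiv C2 (coneSC f1 (-1)) := by
  refine ⟨?_, ?_, ?_⟩
  · exact SCData.sHomotopyEquiv_coneSC_shiftSC h0 h2 h1 hf0 hf2 hf1 hd0 hd2 hd1 hKd0 hKd2
      hK0 hK2 hK1 hN0 hN2 hN1
  · rw [← (coneSC f0 0).shiftSC_zero]
    exact SCData.sHomotopyEquiv_coneSC_shiftSC h1 h0 h2 hf1 hf0 hf2 hd1 hd0 hd2 hKd1 hKd0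
      hK1 hK0 hK2 hN1 hN0 hN2
  · rw [← (coneSC f1 (-1)).shiftSC_zero]
    exact SCData.sHomotopyEquiv_coneSC_shiftSC h2 h1 h0 hf2 hf1 hf0 hd2 hd1 hd0 hKd2 hKd1
      hK2 hK1 hK0 hN2 hN1 hN0
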